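/- arXiv:2605.25462 — 2 statements merged into one kernel-verified Lean document; each statement's English description precedes it below -/
import Mathlib

section
/- Set ξ* := −12^{1/3}. Let Λ ⊂ ℝ² be a lattice of covolume 1, let φ : ℝ² → ℝ be a smooth Λ-periodic function, and let v : (ξ*, 0] × ℝ² → ℝ be a twice continuously differentiable, Λ-periodic solution of the twisted Toda equation (e^v)_{ξξ} + v_{xx} + v_{yy} = −ξ·((12 − 6ξ v_ξ)/(12 + ξ³))·e^v with v(0,·) = φ such that v − 3·log(ξ − ξ*) is bounded. Set φ̄ := log(⨏ e^φ) and v_mod(ξ) := φ̄ + 3·log(1 − ξ/ξ*) + log(1 + ξ/ξ*). Then there exist constants C > 0 and δ > 0 such that |v(ξ,x,y) − v_mod(ξ)| ≤ C·exp(−δ·(ξ − ξ*)^{−1/2}) for all ξ ∈ (ξ*, 0) and all (x,y) ∈ ℝ². -/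
open Real MeasureTheory

noncomputable section

/-- `ξ* = −12^{1/3}`. -/
def xiStar : ℝ := -(12 : ℝ) ^ ((1:ℝ)/3)

/-- The average of a `Λ`-periodic function over the fundamental parallelogram of the
lattice spanned by `v1, v2` (of covolume 1, so there is no Jacobian factor). -/
def sliceAvg (v1 v2 : ℝ × ℝ) (f : ℝ → ℝ → ℝ) : ℝ :=
  ∫ s in (0:ℝ)..1, ∫ t in (0:ℝ)..1, f (s * v1.1 + t * v2.1) (s * v1.2 + t * v2.2)

/-- Periodicity with respect to the lattice generated by `v1, v2`. -/
def LatticePeriodic (v1 v2 : ℝ × ℝ) (f : ℝ → ℝ → ℝ) : Prop :=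
  ∀ x y : ℝ, f (x + v1.1) (y + v1.2) = f x y ∧ f (x + v2.1) (y + v2.2) = f x y

/-- The twisted Toda equation
`(e^v)_{ξξ} + v_{xx} + v_{yy} = −ξ((12 − 6ξv_ξ)/(12 + ξ³))e^v` at `(ξ,x,y)`. -/
def TwistedToda (v : ℝ → ℝ → ℝ → ℝ) (ξ x y : ℝ) : Prop :=
  deriv (deriv (fun s => Real.exp (v s x y))) ξ +
      deriv (deriv (fun x' => v ξ x' y)) x + deriv (deriv (fun y' => v ξ x y')) y =
    -ξ * ((12 - 6 * ξ * deriv (fun s => v s x y) ξ) / (12 + ξ ^ 3)) *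
      Real.exp (v ξ x y)

/-- A C², Λ-periodic solution of the twisted Toda equation on `(ξ*,0] × ℝ²` with
boundary value `φ` at `ξ = 0` and with `v − 3log(ξ − ξ*)` bounded
(boundary value problem BVP3). -/
def IsSolBVP3 (v1 v2 : ℝ × ℝ) (φ : ℝ → ℝ → ℝ) (v : ℝ → ℝ → ℝ → ℝ) : Prop :=
  ContDiffOn ℝ 2 (fun p : ℝ × ℝ × ℝ => v p.1 p.2.1 p.2.2)
    {p : ℝ × ℝ × ℝ | xiStar < p.1 ∧ p.1 ≤ 0} ∧
  (∀ ξ : ℝ, xiStar < ξ → ξ ≤ 0 → LatticePeriodic v1 v2 (v ξ)) ∧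
  (∀ x y : ℝ, v 0 x y = φ x y) ∧
  (∃ M : ℝ, ∀ ξ : ℝ, xiStar < ξ → ξ < 0 → ∀ x y : ℝ,
    |v ξ x y - 3 * Real.log (ξ - xiStar)| ≤ M) ∧
  (∀ ξ : ℝ, xiStar < ξ → ξ < 0 → ∀ x y : ℝ, TwistedToda v ξ x y)

lemma monotoneOn_flux {P F' R : ℝ → ℝ} {L : ℝ}
    (hK : ∀ s ∈ Set.Ioo 0 L, HasDerivAt (fun s => P s * F' s) (R s) s)
    (hR : ∀ s ∈ Set.Ioo 0 L, 0 ≤ R s) :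
    MonotoneOn (fun s => P s * F' s) (Set.Ioo 0 L) := by
  refine monotoneOn_of_deriv_nonneg (convex_Ioo 0 L)
    (fun s hs => (hK s hs).continuousAt.continuousWithinAt) ?_ ?_
  · rw [interior_Ioo]
    exact fun s hs => (hK s hs).differentiableAt.differentiableWithinAt
  · rw [interior_Ioo]
    intro s hs
    rw [(hK s hs).deriv]
    exact hR s hs

/-- Bounded subsolutions of a degenerate operator `∂(P ∂F)` with `P ≲ s⁴` are nondecreasing. -/
lemma deriv_nonneg_of_bounded {P F F' R : ℝ → ℝ} {L k B : ℝ}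
    (hP : ∀ s ∈ Set.Ioo 0 L, 0 < P s ∧ P s ≤ k * s ^ 4)
    (hF : ∀ s ∈ Set.Ioo 0 L, HasDerivAt F (F' s) s)
    (hK : ∀ s ∈ Set.Ioo 0 L, HasDerivAt (fun s => P s * F' s) (R s) s)
    (hR : ∀ s ∈ Set.Ioo 0 L, 0 ≤ R s)
    (hB : ∀ s ∈ Set.Ioo 0 L, 0 ≤ F s ∧ F s ≤ B) :
    ∀ s ∈ Set.Ioo 0 L, 0 ≤ F' s := by
  intro s hs
  by_contra! hneg
  have hmono := monotoneOn_flux hK hR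
  set m := -(P s * F' s) with hm
  have hmpos : 0 < m := by
    have := mul_neg_of_pos_of_neg (hP s hs).1 hneg
    linarith
  have key : ∀ r ∈ Set.Ioo 0 (s / 2), m ≤ 16 * k * B * r ^ 3 := by
    intro r hr
    have hr0 := hr.1
    have hr2 := hr.2
    have hs2 := hs.2
    have hsub : ∀ x ∈ Set.Icc r (2 * r), x ∈ Set.Ioo 0 L := fun x hx =>
      ⟨by linarith [hx.1], by linarith [hx.2]⟩
    obtain ⟨θ, hθ, hθe⟩ := exists_hasDerivAt_eq_slope F F' (by linarith : r < 2 * r)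
      (fun x hx => (hF x (hsub x hx)).continuousAt.continuousWithinAt)
      (fun x hx => hF x (hsub x ⟨hx.1.le, hx.2.le⟩))
    have hθm := hsub θ ⟨hθ.1.le, hθ.2.le⟩
    have h1 : P θ * F' θ ≤ -m := by
      have := hmono hθm hs (by linarith [hθ.2] : θ ≤ s)
      simp only at this
      linarith
    have h2 : F' θ * r = F (2 * r) - F r := by
      rw [hθe]; field_simp; ring
    have h3 := hB r (hsub r ⟨le_rfl, by linarith⟩)
    have h4 := hB (2 * r) (hsub _ ⟨by linarith, le_rfl⟩)
    have h5 : -F' θ * r ≤ B := by linarith [h3.1, h3.2, h4.1, h4.2]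
    have hPθ := hP θ hθm
    have hk : 0 < k := by
      have : 0 < k * θ ^ 4 := hPθ.1.trans_le hPθ.2
      exact pos_of_mul_pos_left this (by positivity)
    have h6 : P θ ≤ 16 * k * r ^ 4 := by
      have : θ ^ 4 ≤ (2 * r) ^ 4 := pow_le_pow_left₀ (by linarith [hθ.1]) hθ.2.le 4
      nlinarith [hPθ.2]
    have hB0 : 0 ≤ B := h3.1.trans h3.2
    have h7 : m * r ≤ P θ * B := by
      have := mul_le_mul_of_nonneg_left h5 hPθ.1.le
      nlinarith
    have h8 : m * r ≤ 16 * k * r ^ 4 * B := h7.trans (mul_le_mul_of_nonneg_right h6 hB0)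
    have : m * r ≤ (16 * k * B * r ^ 3) * r := by linarith [h8, (by ring : 16 * k * r ^ 4 * B = (16 * k * B * r ^ 3) * r)]
    exact le_of_mul_le_mul_right this hr0
  have hlim : Filter.Tendsto (fun r : ℝ => 16 * k * B * r ^ 3) (nhdsWithin 0 (Set.Ioi 0)) (nhds 0) := by
    have : Continuous (fun r : ℝ => 16 * k * B * r ^ 3) := by fun_prop
    have h := this.tendsto 0
    simp only [ne_eq, OfNat.ofNat_ne_zero, not_false_eq_true, zero_pow, mul_zero] at h
    exact h.mono_left nhdsWithin_le_nhds
  have : m ≤ 0 := ge_of_tendsto hlim (by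
    filter_upwards [Ioo_mem_nhdsGT (by linarith [hs.1] : (0:ℝ) < s / 2)] with r hr using key r hr)
  linarith

/-- One step of the Moser iteration, reduced to an ordinary differential inequality. -/
lemma moser_step {P F F' R G G' : ℝ → ℝ} {L k C s l : ℝ} (hC : 0 ≤ C)
    (hP : ∀ s ∈ Set.Ioo 0 L, 0 < P s ∧ P s ≤ k * s ^ 4)
    (hF : ∀ s ∈ Set.Ioo 0 L, HasDerivAt F (F' s) s)
    (hK : ∀ s ∈ Set.Ioo 0 L, HasDerivAt (fun s => P s * F' s) (R s) s)
    (hR : ∀ s ∈ Set.Ioo 0 L, 0 ≤ R s)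
    (hF0 : ∀ s ∈ Set.Ioo 0 L, 0 ≤ F s)
    (hF' : ∀ s ∈ Set.Ioo 0 L, 0 ≤ F' s)
    (hG : ∀ s ∈ Set.Ioo 0 L, HasDerivAt G (G' s) s)
    (hG' : ∀ s ∈ Set.Ioo 0 L, 0 ≤ G' s)
    (hGF : ∀ s ∈ Set.Ioo 0 L, G s ≤ C * (F s * (R s / s + F s)))
    (hs : 0 < s) (hl : 0 < l) (hls : 2 * l ≤ s) (hsL : s + 2 * l < L) :
    G s ≤ C * (16 * k * s ^ 3 / l ^ 2 + 1) * F (s + 2 * l) ^ 2 := by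
  have hmono := monotoneOn_flux hK hR
  have mono : ∀ {f f' : ℝ → ℝ}, (∀ s ∈ Set.Ioo 0 L, HasDerivAt f (f' s) s) →
      (∀ s ∈ Set.Ioo 0 L, 0 ≤ f' s) → MonotoneOn f (Set.Ioo 0 L) := by
    intro f f' h h'
    have := monotoneOn_flux (P := fun _ => 1) (F' := f) (R := f') (L := L) (by simpa using h) h'
    simpa using this
  have hFm := mono hF hF'
  have hGm := mono hG hG'
  have hsub : ∀ x ∈ Set.Icc s (s + 2 * l), x ∈ Set.Ioo 0 L := fun x hx =>
    ⟨by linarith [hx.1], by linarith [hx.2]⟩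
  obtain ⟨θ, hθ, hθe⟩ := exists_hasDerivAt_eq_slope F F' (by linarith : s + l < s + 2 * l)
    (fun x hx => (hF x (hsub x ⟨by linarith [hx.1], hx.2⟩)).continuousAt.continuousWithinAt)
    (fun x hx => hF x (hsub x ⟨by linarith [hx.1], hx.2.le⟩))
  obtain ⟨η, hη, hηe⟩ := exists_hasDerivAt_eq_slope (fun s => P s * F' s) R (by linarith : s < s + l)
    (fun x hx => (hK x (hsub x ⟨hx.1, by linarith [hx.2]⟩)).continuousAt.continuousWithinAt)
    (fun x hx => hK x (hsub x ⟨hx.1.le, by linarith [hx.2]⟩))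
  have hθm := hsub θ ⟨by linarith [hθ.1], hθ.2.le⟩
  have hηm := hsub η ⟨by linarith [hη.1], by linarith [hη.2]⟩
  have hsm := hsub s ⟨le_rfl, by linarith⟩
  have hs1 := hsub (s + l) ⟨by linarith, by linarith⟩
  have hs2 := hsub (s + 2 * l) ⟨by linarith, by linarith⟩
  have hPθ := hP θ hθm
  have hk : 0 < k := by
    have : 0 < k * θ ^ 4 := hPθ.1.trans_le hPθ.2
    exact pos_of_mul_pos_left this (by positivity)
  set X := F (s + 2 * l) with hX
  have hX0 : 0 ≤ X := hF0 _ hs2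
  have e1 : F' θ * l = X - F (s + l) := by
    rw [hθe, (by ring : s + 2 * l - (s + l) = l), div_mul_cancel₀ _ hl.ne']
  have e2 : R η * l = P (s + l) * F' (s + l) - P s * F' s := by
    rw [hηe, (by ring : s + l - s = l), div_mul_cancel₀ _ hl.ne']
  have h1 : P (s + l) * F' (s + l) ≤ P θ * F' θ := hmono hs1 hθm hθ.1.le
  have h2 : 0 ≤ P s * F' s := mul_nonneg (hP s hsm).1.le (hF' s hsm)
  have h3 : P θ ≤ 16 * k * s ^ 4 := by
    have : θ ^ 4 ≤ (2 * s) ^ 4 := pow_le_pow_left₀ hθm.1.le (by linarith [hθ.2]) 4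
    nlinarith [hPθ.2]
  have h4 : R η * l ^ 2 ≤ 16 * k * s ^ 4 * X := by
    calc R η * l ^ 2 = (R η * l) * l := by ring
      _ ≤ (P θ * F' θ) * l := mul_le_mul_of_nonneg_right (by linarith) hl.le
      _ = P θ * (F' θ * l) := by ring
      _ ≤ P θ * X := mul_le_mul_of_nonneg_left (by linarith [hF0 _ hs1]) hPθ.1.le
      _ ≤ _ := mul_le_mul_of_nonneg_right h3 hX0
  have h5 : R η / η ≤ 16 * k * s ^ 3 / l ^ 2 * X := by
    calc R η / η ≤ R η / s := div_le_div_of_nonneg_left (hR η hηm) hs hη.1.le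
      _ ≤ _ := by
        rw [div_le_iff₀ hs, div_mul_eq_mul_div, div_mul_eq_mul_div, le_div_iff₀ (by positivity)]
        linarith [h4, (by ring : 16 * k * s ^ 3 * X * s = 16 * k * s ^ 4 * X)]
  have h6 : F η ≤ X := hFm hηm hs2 (by linarith [hη.2])
  have h7 : G s ≤ G η := hGm hsm hηm hη.1.le
  have h8 : 0 ≤ R η / η := div_nonneg (hR η hηm) hηm.1.le
  calc G s ≤ C * (F η * (R η / η + F η)) := h7.trans (hGF η hηm)
    _ ≤ C * (X * (16 * k * s ^ 3 / l ^ 2 * X + X)) := by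
      gcongr
      exact add_nonneg h8 (hF0 η hηm)
    _ = _ := by ring

/-- The Moser iteration for a sequence of energies. -/
lemma moser_iteration {P : ℝ → ℝ} {F F' R : ℕ → ℝ → ℝ} {L k C : ℝ} {B : ℕ → ℝ} (hC : 1 ≤ C)
    (hL : 0 < L) (hk : 0 < k)
    (hP : ∀ s ∈ Set.Ioo 0 L, 0 < P s ∧ P s ≤ k * s ^ 4)
    (hF : ∀ n, ∀ s ∈ Set.Ioo 0 L, HasDerivAt (F n) (F' n s) s)
    (hK : ∀ n, ∀ s ∈ Set.Ioo 0 L, HasDerivAt (fun s => P s * F' n s) (R n s) s)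
    (hR : ∀ n, ∀ s ∈ Set.Ioo 0 L, 0 ≤ R n s)
    (hB : ∀ n, ∀ s ∈ Set.Ioo 0 L, 0 ≤ F n s ∧ F n s ≤ B n)
    (hFF : ∀ n, ∀ s ∈ Set.Ioo 0 L, F (n + 1) s ≤ C * (F n s * (R n s / s + F n s))) :
    ∃ D : ℝ, 1 ≤ D ∧ ∀ s, 0 < s → 2 * s < L → ∀ n, F n s ≤ (D * F 0 (2 * s)) ^ 2 ^ n := by
  have hF' : ∀ n, ∀ s ∈ Set.Ioo 0 L, 0 ≤ F' n s := fun n =>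
    deriv_nonneg_of_bounded hP (hF n) (hK n) (hR n) (hB n)
  have hC0 : 0 < C := by linarith
  set C' := C * (2048 * k * L + 1) with hC'
  have hC'1 : 1 ≤ C' := by
    rw [hC']
    have : 1 ≤ 2048 * k * L + 1 := by have := mul_pos hk hL; nlinarith
    nlinarith
  refine ⟨4 * C', by linarith, fun s hs hsL n => ?_⟩
  have mono : ∀ n, MonotoneOn (F n) (Set.Ioo 0 L) := by
    intro n
    have := monotoneOn_flux (P := fun _ => 1) (F' := F n) (R := F' n) (L := L) (by simpa using hF n) (hF' n)
    simpa using this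
  set σ : ℕ → ℝ := fun n => s * (1 + (1 / 2) ^ n) with hσ
  have hpow : ∀ n : ℕ, 0 < ((1:ℝ) / 2) ^ n ∧ ((1:ℝ) / 2) ^ n ≤ 1 := fun n =>
    ⟨by positivity, pow_le_one₀ (by norm_num) (by norm_num)⟩
  have hσm : ∀ n, s ≤ σ n ∧ σ n ≤ 2 * s := fun n => by
    have := hpow n
    constructor <;> simp only [hσ] <;> nlinarith
  have hσI : ∀ n, σ n ∈ Set.Ioo 0 L := fun n => ⟨by linarith [(hσm n).1], by linarith [(hσm n).2]⟩
  have step : ∀ n, F (n + 1) (σ (n + 1)) ≤ C' * 4 ^ n * F n (σ n) ^ 2 := by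
    intro n
    set l := s * (1 / 2) ^ n / 4 with hl
    have hp := hpow n
    have hl0 : 0 < l := by rw [hl]; have := hp.1; positivity
    have e : σ (n + 1) + 2 * l = σ n := by simp only [hσ, hl, pow_succ]; ring
    have h1 := moser_step (s := σ (n + 1)) (l := l) hC0.le hP (hF n) (hK n) (hR n)
      (fun s hs => (hB n s hs).1) (hF' n) (hF (n + 1)) (hF' (n + 1)) (hFF n) (hσI (n + 1)).1 hl0
      (by have := (hσm (n+1)).1; rw [hl]; nlinarith) (by rw [e]; exact (hσI n).2)
    rw [e] at h1
    refine h1.trans ?_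
    have h4 : (1:ℝ) ≤ 4 ^ n := one_le_pow₀ (by norm_num)
    have h5 : 16 * k * σ (n + 1) ^ 3 / l ^ 2 ≤ 2048 * k * L * 4 ^ n := by
      have h6 : σ (n + 1) ^ 3 ≤ (2 * s) ^ 3 := pow_le_pow_left₀ (hσI _).1.le (hσm _).2 3
      have h7 : l ^ 2 * 4 ^ n = s ^ 2 / 16 := by
        have : ((1:ℝ) / 2) ^ n * (1 / 2) ^ n * 4 ^ n = 1 := by
          rw [← mul_pow, ← mul_pow]; norm_num
        rw [hl]; linear_combination (s ^ 2 / 16) * this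
      rw [div_le_iff₀ (by positivity)]
      calc 16 * k * σ (n + 1) ^ 3 ≤ 16 * k * (2 * s) ^ 3 := by gcongr
        _ = 128 * k * s ^ 2 * s := by ring
        _ ≤ 128 * k * s ^ 2 * L :=
          mul_le_mul_of_nonneg_left (by linarith) (by positivity)
        _ = 2048 * k * L * (l ^ 2 * 4 ^ n) := by rw [h7]; ring
        _ = _ := by ring
    have h8 : C * (16 * k * σ (n + 1) ^ 3 / l ^ 2 + 1) ≤ C' * 4 ^ n := by
      calc C * (16 * k * σ (n + 1) ^ 3 / l ^ 2 + 1)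
          ≤ C * (2048 * k * L * 4 ^ n + 4 ^ n) := by gcongr
        _ = _ := by rw [hC']; ring
    exact mul_le_mul_of_nonneg_right h8 (sq_nonneg _)
  have main : ∀ n, 4 * C' * 4 ^ n * F n (σ n) ≤ (4 * C' * F 0 (2 * s)) ^ 2 ^ n := by
    intro n
    induction n with
    | zero => simp [hσ, mul_comm, one_add_one_eq_two]
    | succ n ih =>
      have h0 := (hB n _ (hσI n)).1
      have hC'0 : 0 < C' := by linarith
      calc 4 * C' * 4 ^ (n + 1) * F (n + 1) (σ (n + 1))
          ≤ 4 * C' * 4 ^ (n + 1) * (C' * 4 ^ n * F n (σ n) ^ 2) := by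
            gcongr; exact step n
        _ = (4 * C' * 4 ^ n * F n (σ n)) ^ 2 := by ring
        _ ≤ ((4 * C' * F 0 (2 * s)) ^ 2 ^ n) ^ 2 := by gcongr
        _ = _ := by rw [← pow_mul, pow_succ]
  have hsI : s ∈ Set.Ioo 0 L := ⟨hs, by linarith⟩
  have h1 : F n s ≤ F n (σ n) := mono n hsI (hσI n) (hσm n).1
  have h4 : (1:ℝ) ≤ 4 * C' * 4 ^ n := by
    have : (1:ℝ) ≤ 4 ^ n := one_le_pow₀ (by norm_num)
    nlinarith
  have h0 := (hB n _ (hσI n)).1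
  nlinarith [main n]


lemma hasDerivAt_inv_sqrt {s : ℝ} (hs : 0 < s) :
    HasDerivAt (fun s : ℝ => (√s)⁻¹) (-((√s)⁻¹ ^ 3 / 2)) s := by
  have h := (Real.hasDerivAt_sqrt hs.ne').inv (Real.sqrt_pos.2 hs).ne'
  exact h.congr_deriv (by field_simp)

lemma hasDerivAt_exp_neg_inv_sqrt (η : ℝ) {s : ℝ} (hs : 0 < s) :
    HasDerivAt (fun s : ℝ => exp (-η * (√s)⁻¹))
      (η / 2 * (√s)⁻¹ ^ 3 * exp (-η * (√s)⁻¹)) s := by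
  convert ((hasDerivAt_inv_sqrt hs).const_mul (-η)).exp using 1
  ring

/-- `exp (-η / √s)` is a supersolution of `∂(P ∂F) = c s F` when `P ~ s⁴` and `η` is small. -/
lemma exp_neg_inv_sqrt_supersolution {P P' : ℝ → ℝ} {L k c : ℝ} (hL : 0 < L) (hk : 0 < k)
    (hc : 0 < c)
    (hP : ∀ s ∈ Set.Ioo 0 L, 0 < P s ∧ P s ≤ k * s ^ 4)
    (hP' : ∀ s ∈ Set.Ioo 0 L, HasDerivAt P (P' s) s ∧ |P' s| ≤ k * s ^ 3) :
    ∃ δ > (0:ℝ), ∀ η, |η| ≤ δ → ∀ s ∈ Set.Ioo 0 L, ∃ D,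
      HasDerivAt (fun s => P s * (η / 2 * (√s)⁻¹ ^ 3 * exp (-η * (√s)⁻¹))) D s ∧
      D ≤ c * s * exp (-η * (√s)⁻¹) := by
  refine ⟨min 1 (c / (k * (2 * √L + 1))), by positivity, fun η hη s hs => ?_⟩
  have hs0 := hs.1
  have hq : 0 < √s := Real.sqrt_pos.2 hs0
  refine ⟨_, (hP' s hs).1.mul (((((hasDerivAt_inv_sqrt hs0).pow 3).const_mul (η / 2)).mul
    (hasDerivAt_exp_neg_inv_sqrt η hs0))), ?_⟩
  set E := exp (-η * (√s)⁻¹) with hE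
  have hEpos : 0 < E := exp_pos _
  set q := √s with hqd
  have hsq : s = q ^ 2 := (Real.sq_sqrt hs0.le).symm
  have hqL : q ≤ √L := Real.sqrt_le_sqrt hs.2.le
  have h1 : |P' s * (η / 2 * q⁻¹ ^ 3)| ≤ |η| / 2 * k * q ^ 3 := by
    rw [abs_mul, abs_mul, abs_of_pos (by positivity : 0 < q⁻¹ ^ 3), abs_div, abs_two]
    calc |P' s| * (|η| / 2 * q⁻¹ ^ 3) ≤ (k * s ^ 3) * (|η| / 2 * q⁻¹ ^ 3) := by
          gcongr; exact (hP' s hs).2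
      _ = _ := by rw [hsq]; field_simp
  have h2 : |P s * (η / 2 * (3 * q⁻¹ ^ 5 / 2))| ≤ 3 * |η| / 4 * k * q ^ 3 := by
    rw [abs_mul, abs_mul, abs_of_pos (by positivity : 0 < 3 * q⁻¹ ^ 5 / 2), abs_div, abs_two,
      abs_of_pos (hP s hs).1]
    calc P s * (|η| / 2 * (3 * q⁻¹ ^ 5 / 2)) ≤ (k * s ^ 4) * (|η| / 2 * (3 * q⁻¹ ^ 5 / 2)) := by
          gcongr; exact (hP s hs).2
      _ = _ := by rw [hsq]; field_simp; ring
  have h3 : P s * (η / 2 * q⁻¹ ^ 3) ^ 2 ≤ |η| ^ 2 / 4 * k * q ^ 2 := by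
    rw [sq_abs]
    calc P s * (η / 2 * q⁻¹ ^ 3) ^ 2 ≤ (k * s ^ 4) * (η / 2 * q⁻¹ ^ 3) ^ 2 := by
          gcongr; exact (hP s hs).2
      _ = _ := by rw [hsq]; field_simp; ring
  have h4 : |η| * (k * (2 * √L + 1)) ≤ c := by
    rw [← le_div_iff₀ (by positivity)]
    exact hη.trans (min_le_right _ _)
  have h5 : |η| ≤ 1 := hη.trans (min_le_left _ _)
  have h6 : P' s * (η / 2 * q⁻¹ ^ 3) - P s * (η / 2 * (3 * q⁻¹ ^ 5 / 2)) +
      P s * (η / 2 * q⁻¹ ^ 3) ^ 2 ≤ c * q ^ 2 := by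
    have hη0 := abs_nonneg η
    have h7 : |η| / 2 * k * q ^ 3 ≤ |η| / 2 * k * q ^ 2 * √L := by
      calc |η| / 2 * k * q ^ 3 = |η| / 2 * k * q ^ 2 * q := by ring
        _ ≤ _ := by gcongr
    have h8 : |η| ^ 2 / 4 * k * q ^ 2 ≤ |η| / 4 * k * q ^ 2 := by
      gcongr; nlinarith
    have h9 : |η| * (k * (2 * √L + 1)) * q ^ 2 ≤ c * q ^ 2 := by gcongr
    have h10 : 0 ≤ |η| * k * q ^ 2 * √L := by positivity
    have h11 : 0 ≤ |η| * k * q ^ 2 := by positivity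
    nlinarith [abs_le.1 h1, abs_le.1 h2]
  calc _ = (P' s * (η / 2 * q⁻¹ ^ 3) - P s * (η / 2 * (3 * q⁻¹ ^ 5 / 2)) +
      P s * (η / 2 * q⁻¹ ^ 3) ^ 2) * E := by
        simp only [Pi.pow_apply, Nat.cast_ofNat]
        ring
    _ ≤ c * q ^ 2 * E := by gcongr
    _ = _ := by rw [hsq]

/-- A function with `∂(P ∂W) > 0` has no interior local maximum. -/
lemma not_isLocalMax_of_flux_deriv_pos {P W W' : ℝ → ℝ} {s D : ℝ}
    (hP : ∀ᶠ x in nhds s, 0 < P x)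
    (hW : ∀ᶠ x in nhds s, HasDerivAt W (W' x) x)
    (hK : HasDerivAt (fun x => P x * W' x) D s) (hD : 0 < D) : ¬ IsLocalMax W s := by
  intro hmax
  have h0 : W' s = 0 := hmax.hasDerivAt_eq_zero hW.self_of_nhds
  have hpos : ∀ᶠ x in nhdsWithin s (Set.Ioi s), 0 < P x * W' x := by
    have h := (hasDerivAt_iff_tendsto_slope.1 hK).eventually (lt_mem_nhds hD)
    have h' := h.filter_mono (nhdsWithin_mono s (fun x (hx : s < x) => (ne_of_gt hx : x ≠ s)))
    filter_upwards [h', self_mem_nhdsWithin] with x hx hsx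
    rw [slope_def_field, h0, mul_zero, sub_zero] at hx
    have : 0 < x - s := sub_pos.2 hsx
    by_contra! hle
    exact absurd hx (not_lt.2 (div_nonpos_of_nonpos_of_nonneg hle this.le))
  have hall := hpos.and (((hP.and hW).and hmax).filter_mono nhdsWithin_le_nhds)
  obtain ⟨b, hb, hbs⟩ := (mem_nhdsGT_iff_exists_Ioo_subset).1 hall
  have hb' : s < b := hb
  obtain ⟨θ, hθ, hθe⟩ := exists_hasDerivAt_eq_slope W W' (by linarith : s < (s + b) / 2)
    (fun x hx => by
      rcases hx.1.eq_or_lt with h | h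
      · rw [← h]; exact hW.self_of_nhds.continuousAt.continuousWithinAt
      · exact (hbs ⟨h, by linarith [hx.2]⟩).2.1.2.continuousAt.continuousWithinAt)
    (fun x hx => (hbs ⟨hx.1, by linarith [hx.2]⟩).2.1.2)
  have hθ' := hbs (⟨hθ.1, by linarith [hθ.2]⟩ : θ ∈ Set.Ioo s b)
  have hm' := hbs (⟨by linarith, by linarith⟩ : (s + b) / 2 ∈ Set.Ioo s b)
  have h1 : 0 < W' θ := pos_of_mul_pos_right hθ'.1 hθ'.2.1.1.le
  have h2 : W ((s + b) / 2) ≤ W s := hm'.2.2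
  rw [hθe] at h1
  have : (W ((s + b) / 2) - W s) / ((s + b) / 2 - s) ≤ 0 :=
    div_nonpos_of_nonpos_of_nonneg (by linarith) (by linarith)
  linarith

/-- Bounded solutions of `∂(P ∂F) ≥ c s F` with `P ~ s⁴` decay like `exp (-δ / √s)`. -/
lemma exp_decay_of_bounded {P P' F F' R : ℝ → ℝ} {L k c B : ℝ} (hL : 0 < L) (hk : 0 < k)
    (hc : 0 < c)
    (hP : ∀ s ∈ Set.Ioo 0 L, 0 < P s ∧ P s ≤ k * s ^ 4)
    (hP' : ∀ s ∈ Set.Ioo 0 L, HasDerivAt P (P' s) s ∧ |P' s| ≤ k * s ^ 3)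
    (hF : ∀ s ∈ Set.Ioo 0 L, HasDerivAt F (F' s) s)
    (hK : ∀ s ∈ Set.Ioo 0 L, HasDerivAt (fun s => P s * F' s) (R s) s)
    (hR : ∀ s ∈ Set.Ioo 0 L, c * s * F s ≤ R s)
    (hB : ∀ s ∈ Set.Ioo 0 L, F s ≤ B) :
    ∃ A > (0:ℝ), ∃ δ > (0:ℝ), ∀ s, 0 < s → s ≤ L / 2 → F s ≤ A * exp (-δ * (√s)⁻¹) := by
  obtain ⟨δ, hδ, hsup⟩ := exp_neg_inv_sqrt_supersolution hL hk (half_pos hc) hP hP'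
  set A := (|B| + 1) * exp (δ * (√(L / 2))⁻¹) with hA
  have hApos : 0 < A := by positivity
  refine ⟨A, hApos, δ, hδ, fun s hs hsL => ?_⟩
  have main : ∀ ε > (0:ℝ), F s ≤ A * exp (-δ * (√s)⁻¹) + ε * exp (δ * (√s)⁻¹) := by
    intro ε hε
    by_contra! hlt
    set W : ℝ → ℝ := fun s => F s - A * exp (-δ * (√s)⁻¹) - ε * exp (-(-δ) * (√s)⁻¹) with hW
    set W' : ℝ → ℝ := fun s => F' s - A * (δ / 2 * (√s)⁻¹ ^ 3 * exp (-δ * (√s)⁻¹)) -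
      ε * (-δ / 2 * (√s)⁻¹ ^ 3 * exp (-(-δ) * (√s)⁻¹)) with hW'
    have hWd : ∀ x ∈ Set.Ioo 0 L, HasDerivAt W (W' x) x := fun x hx =>
      ((hF x hx).sub ((hasDerivAt_exp_neg_inv_sqrt δ hx.1).const_mul A)).sub
        ((hasDerivAt_exp_neg_inv_sqrt (-δ) hx.1).const_mul ε)
    have hWs : 0 < W s := by simp only [hW, neg_neg]; linarith
    have hWL : W (L / 2) < 0 := by
      have h1 := hB (L / 2) ⟨by linarith, by linarith⟩
      have h2 : A * exp (-δ * (√(L / 2))⁻¹) = |B| + 1 := by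
        rw [hA, mul_assoc, ← exp_add]; simp
      have h3 : 0 < ε * exp (-(-δ) * (√(L / 2))⁻¹) := by positivity
      simp only [hW, h2]
      linarith [le_abs_self B]
    obtain ⟨a, ha, has, hWa⟩ : ∃ a, 0 < a ∧ a < s ∧ W a < 0 := by
      have hlim : Filter.Tendsto (fun s : ℝ => ε * exp (-(-δ) * (√s)⁻¹))
          (nhdsWithin 0 (Set.Ioi 0)) Filter.atTop := by
        refine Filter.Tendsto.const_mul_atTop hε (Real.tendsto_exp_atTop.comp ?_)
        refine Filter.Tendsto.const_mul_atTop (by linarith) ?_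
        refine Filter.Tendsto.inv_tendsto_nhdsGT_zero ?_
        refine tendsto_nhdsWithin_iff.2 ⟨?_, ?_⟩
        · have := (Real.continuous_sqrt.tendsto 0)
          rw [Real.sqrt_zero] at this
          exact this.mono_left nhdsWithin_le_nhds
        · filter_upwards [self_mem_nhdsWithin] with x hx using Real.sqrt_pos.2 hx
      have h1 := hlim.eventually (Filter.eventually_gt_atTop B)
      obtain ⟨a, ha, ha'⟩ := (h1.and (Ioo_mem_nhdsGT hs)).exists
      refine ⟨a, ha'.1, ha'.2, ?_⟩
      have h2 := hB a ⟨ha'.1, by linarith [ha'.2]⟩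
      have h3 : 0 < A * exp (-δ * (√a)⁻¹) := by positivity
      simp only [hW]
      linarith
    have hIcc : ∀ x ∈ Set.Icc a (L / 2), x ∈ Set.Ioo 0 L := fun x hx =>
      ⟨by linarith [hx.1], by linarith [hx.2]⟩
    obtain ⟨m, hm, hmax⟩ := isCompact_Icc.exists_isMaxOn ⟨s, has.le, hsL⟩
      (fun x hx => (hWd x (hIcc x hx)).continuousAt.continuousWithinAt)
    have hWm : 0 < W m := hWs.trans_le (hmax ⟨has.le, hsL⟩)
    have hm1 : a < m := lt_of_le_of_ne hm.1 (by rintro rfl; linarith)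
    have hm2 : m < L / 2 := lt_of_le_of_ne hm.2 (by rintro rfl; linarith)
    have hmI := hIcc m hm
    have hnhds : Set.Ioo 0 L ∈ nhds m := Ioo_mem_nhds hmI.1 hmI.2
    obtain ⟨D1, hD1, hD1'⟩ := hsup δ (by rw [abs_of_pos hδ]) m hmI
    obtain ⟨D2, hD2, hD2'⟩ := hsup (-δ) (by rw [abs_neg, abs_of_pos hδ]) m hmI
    refine not_isLocalMax_of_flux_deriv_pos (P := P) (W := W) (W' := W') (s := m)
      (D := R m - A * D1 - ε * D2)
      (Filter.eventually_of_mem hnhds fun x hx => (hP x hx).1)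
      (Filter.eventually_of_mem hnhds hWd) ?_ ?_ (hmax.isLocalMax (Icc_mem_nhds hm1 hm2))
    · have h := ((hK m hmI).sub (hD1.const_mul A)).sub (hD2.const_mul ε)
      refine h.congr_of_eventuallyEq (Filter.Eventually.of_forall fun x => ?_)
      simp only [hW', Pi.sub_apply]
      ring
    · have h1 := hR m hmI
      have h2 := mul_le_mul_of_nonneg_left hD1' hApos.le
      have h3 := mul_le_mul_of_nonneg_left hD2' hε.le
      have h4 : 0 < c * m * W m := mul_pos (mul_pos hc hmI.1) hWm
      have h5 : 0 < c / 2 * m * (A * exp (-δ * (√m)⁻¹)) :=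
        mul_pos (mul_pos (half_pos hc) hmI.1) (by positivity)
      have h6 : 0 < c / 2 * m * (ε * exp (-(-δ) * (√m)⁻¹)) :=
        mul_pos (mul_pos (half_pos hc) hmI.1) (by positivity)
      simp only [hW] at h4
      nlinarith
  have hlim : Filter.Tendsto (fun ε : ℝ => A * exp (-δ * (√s)⁻¹) + ε * exp (δ * (√s)⁻¹))
      (nhdsWithin 0 (Set.Ioi 0)) (nhds (A * exp (-δ * (√s)⁻¹))) := by
    have hc : Continuous (fun ε : ℝ => A * exp (-δ * (√s)⁻¹) + ε * exp (δ * (√s)⁻¹)) := by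
      fun_prop
    have := hc.tendsto 0
    rw [zero_mul, add_zero] at this
    exact this.mono_left nhdsWithin_le_nhds
  exact ge_of_tendsto hlim (by filter_upwards [self_mem_nhdsWithin] with ε hε using main ε hε)


/-- The closed unit square, a fundamental domain of `ℤ²`. -/
def unitSquare : Set (ℝ × ℝ) := Set.Icc 0 1 ×ˢ Set.Icc 0 1

lemma isCompact_unitSquare : IsCompact unitSquare := isCompact_Icc.prod isCompact_Icc

lemma Continuous.integrableOn_unitSquare {f : ℝ × ℝ → ℝ} (hf : Continuous f) :
    IntegrableOn f unitSquare :=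
  hf.continuousOn.integrableOn_compact isCompact_unitSquare

lemma volume_unitSquare : volume unitSquare = 1 := by
  rw [unitSquare, Measure.volume_eq_prod, Measure.prod_prod]; simp

instance : IsProbabilityMeasure (volume.restrict unitSquare) :=
  ⟨by rw [Measure.restrict_apply_univ, volume_unitSquare]⟩

lemma integral_unitSquare {f : ℝ × ℝ → ℝ} (hf : Continuous f) :
    ∫ z in unitSquare, f z = ∫ a in (0:ℝ)..1, ∫ b in (0:ℝ)..1, f (a, b) := by
  have h := hf.integrableOn_unitSquare
  rw [unitSquare, Measure.volume_eq_prod] at h ⊢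
  rw [setIntegral_prod _ h]
  simp only [intervalIntegral.integral_of_le zero_le_one, integral_Icc_eq_integral_Ioc]

lemma integral_unitSquare' {f : ℝ × ℝ → ℝ} (hf : Continuous f) :
    ∫ z in unitSquare, f z = ∫ b in (0:ℝ)..1, ∫ a in (0:ℝ)..1, f (a, b) := by
  have e := integral_unitSquare (f := fun z => f z.swap) (by fun_prop)
  simp only [Prod.swap_prod_mk] at e
  rw [← e]
  have h := (Measure.measurePreserving_swap (μ := (volume : Measure ℝ))
    (ν := (volume : Measure ℝ))).setIntegral_preimage_emb
    MeasurableEquiv.prodComm.measurableEmbedding f unitSquare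
  rw [← Measure.volume_eq_prod] at h
  rw [← h]
  congr 2
  ext z
  simp [unitSquare]

lemma integral_mono_unitSquare {f g : ℝ × ℝ → ℝ} (hf : Continuous f) (hg : Continuous g)
    (h : ∀ z ∈ unitSquare, f z ≤ g z) : ∫ z in unitSquare, f z ≤ ∫ z in unitSquare, g z :=
  setIntegral_mono_on hf.integrableOn_unitSquare hg.integrableOn_unitSquare
    isCompact_unitSquare.measurableSet h

lemma continuous_integral_fst {f : ℝ × ℝ → ℝ} (hf : Continuous f) :
    Continuous fun b => ∫ a in (0:ℝ)..1, f (a, b) :=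
  intervalIntegral.continuous_parametric_intervalIntegral_of_continuous'
    (f := fun b a => f (a, b)) (by simpa [Function.uncurry_def] using by fun_prop) 0 1

lemma continuous_integral_snd {f : ℝ × ℝ → ℝ} (hf : Continuous f) :
    Continuous fun a => ∫ b in (0:ℝ)..1, f (a, b) :=
  intervalIntegral.continuous_parametric_intervalIntegral_of_continuous'
    (f := fun a b => f (a, b)) (by simpa [Function.uncurry_def] using by fun_prop) 0 1

lemma sq_integral_mul_le {α : Type*} [MeasurableSpace α] {μ : Measure α} {f g : α → ℝ}
    (hf : Integrable (fun x => f x ^ 2) μ) (hg : Integrable (fun x => g x ^ 2) μ)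
    (hfg : Integrable (fun x => f x * g x) μ) :
    (∫ x, f x * g x ∂μ) ^ 2 ≤ (∫ x, f x ^ 2 ∂μ) * ∫ x, g x ^ 2 ∂μ := by
  have h : ∀ t : ℝ, 0 ≤ (∫ x, g x ^ 2 ∂μ) * (t * t) + (2 * ∫ x, f x * g x ∂μ) * t +
      ∫ x, f x ^ 2 ∂μ := by
    intro t
    have e : ∫ x, (f x + t * g x) ^ 2 ∂μ = (∫ x, g x ^ 2 ∂μ) * (t * t) +
        (2 * ∫ x, f x * g x ∂μ) * t + ∫ x, f x ^ 2 ∂μ := by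
      have : (fun x => (f x + t * g x) ^ 2) =
          fun x => ((t * t) * g x ^ 2 + (2 * t) * (f x * g x)) + f x ^ 2 := by
        funext x; ring
      have hi : Integrable (fun x => (t * t) * g x ^ 2 + (2 * t) * (f x * g x)) μ :=
        (hg.const_mul _).add (hfg.const_mul _)
      rw [this, integral_add hi hf,
        integral_add (hg.const_mul _) (hfg.const_mul _), integral_const_mul, integral_const_mul]
      ring
    rw [← e]
    exact integral_nonneg fun x => sq_nonneg _
  have := discrim_le_zero h
  rw [discrim] at this
  nlinarith

lemma abs_sub_le_integral_abs_deriv {f f' : ℝ → ℝ} (hf : ∀ x, HasDerivAt f (f' x) x)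
    (hf' : Continuous f') {a b : ℝ} (ha : a ∈ Set.Icc (0:ℝ) 1) (hb : b ∈ Set.Icc (0:ℝ) 1) :
    |f a - f b| ≤ ∫ x in (0:ℝ)..1, |f' x| := by
  have h1 : ∫ x in b..a, f' x = f a - f b :=
    intervalIntegral.integral_eq_sub_of_hasDerivAt (fun x _ => hf x) (hf'.intervalIntegrable _ _)
  rw [← h1]
  refine (intervalIntegral.norm_integral_le_abs_integral_norm (f := f') (a := b) (b := a) (μ := volume)).trans ?_
  refine (intervalIntegral.abs_integral_mono_interval (μ := volume) (f := fun x => ‖f' x‖) (c := 0) (d := 1) ?_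
    (Filter.Eventually.of_forall fun x => abs_nonneg _)
    (hf'.abs.intervalIntegrable _ _)).trans ?_
  · rw [Set.uIoc_of_le zero_le_one, Set.uIoc]
    exact Set.Ioc_subset_Ioc (le_inf hb.1 ha.1) (sup_le hb.2 ha.2)
  · rw [abs_of_nonneg (intervalIntegral.integral_nonneg zero_le_one fun x _ => norm_nonneg _)]
    rfl

lemma sub_sq_le_integral_sq_deriv {f f' : ℝ → ℝ} (hf : ∀ x, HasDerivAt f (f' x) x)
    (hf' : Continuous f') {a b : ℝ} (ha : a ∈ Set.Icc (0:ℝ) 1) (hb : b ∈ Set.Icc (0:ℝ) 1) :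
    (f a - f b) ^ 2 ≤ ∫ x in (0:ℝ)..1, f' x ^ 2 := by
  have h1 := abs_sub_le_integral_abs_deriv hf hf' ha hb
  have h2 : (∫ x in (0:ℝ)..1, |f' x|) ^ 2 ≤ ∫ x in (0:ℝ)..1, f' x ^ 2 := by
    simp only [intervalIntegral.integral_of_le zero_le_one]
    have := sq_integral_mul_le (μ := volume.restrict (Set.Ioc (0:ℝ) 1)) (f := fun x => |f' x|)
      (g := fun _ => 1) ?_ ?_ ?_
    · simpa using this
    · exact ((hf'.abs.pow 2).intervalIntegrable 0 1).1
    · exact ((continuous_const).intervalIntegrable 0 1).1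
    · exact ((hf'.abs.mul continuous_const).intervalIntegrable 0 1).1
  calc (f a - f b) ^ 2 = |f a - f b| ^ 2 := (sq_abs _).symm
    _ ≤ _ := (pow_le_pow_left₀ (abs_nonneg _) h1 2).trans h2

lemma sq_le_integral_add {f f' : ℝ → ℝ} (hf : ∀ x, HasDerivAt f (f' x) x)
    (hf' : Continuous f') {a : ℝ} (ha : a ∈ Set.Icc (0:ℝ) 1) :
    f a ^ 2 ≤ ∫ x in (0:ℝ)..1, (f x ^ 2 + 2 * |f x * f' x|) := by
  have hfc : Continuous f := continuous_iff_continuousAt.2 fun x => (hf x).continuousAt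
  have hd : ∀ x, HasDerivAt (fun x => f x ^ 2) (2 * (f x * f' x)) x := fun x => by
    exact ((hf x).pow 2).congr_deriv (by push_cast; ring)
  have h1 : ∀ b ∈ Set.Icc (0:ℝ) 1, f a ^ 2 ≤ f b ^ 2 + ∫ x in (0:ℝ)..1, 2 * |f x * f' x| := by
    intro b hb
    have := abs_sub_le_integral_abs_deriv hd (by fun_prop) ha hb
    simp only [abs_mul (2:ℝ), abs_two] at this
    linarith [le_abs_self (f a ^ 2 - f b ^ 2)]
  have h2 := intervalIntegral.integral_mono_on (μ := volume) zero_le_one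
    (continuous_const.intervalIntegrable 0 1)
    ((by fun_prop : Continuous fun b => f b ^ 2 + ∫ x in (0:ℝ)..1, 2 * |f x * f' x|).intervalIntegrable
      0 1) h1
  rw [intervalIntegral.integral_add, intervalIntegral.integral_const,
    intervalIntegral.integral_const] at h2
  · rw [intervalIntegral.integral_add]
    · simpa using h2
    · exact Continuous.intervalIntegrable (by fun_prop) _ _
    · exact Continuous.intervalIntegrable (by fun_prop) _ _
  · exact Continuous.intervalIntegrable (by fun_prop) _ _
  · exact Continuous.intervalIntegrable (by fun_prop) _ _

lemma hasDerivAt_fst {f : ℝ × ℝ → ℝ} (hf : ContDiff ℝ 1 f) (a b : ℝ) :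
    HasDerivAt (fun a => f (a, b)) (fderiv ℝ f (a, b) (1, 0)) a :=
  ((hf.differentiable one_ne_zero (a, b)).hasFDerivAt).comp_hasDerivAt a
    ((hasDerivAt_id a).prodMk (hasDerivAt_const a b))

lemma hasDerivAt_snd {f : ℝ × ℝ → ℝ} (hf : ContDiff ℝ 1 f) (a b : ℝ) :
    HasDerivAt (fun b => f (a, b)) (fderiv ℝ f (a, b) (0, 1)) b :=
  ((hf.differentiable one_ne_zero (a, b)).hasFDerivAt).comp_hasDerivAt b
    ((hasDerivAt_const b a).prodMk (hasDerivAt_id b))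

lemma continuous_fderiv_apply_const {f : ℝ × ℝ → ℝ} (hf : ContDiff ℝ 1 f) (e : ℝ × ℝ) :
    Continuous fun z => fderiv ℝ f z e :=
  (hf.continuous_fderiv one_ne_zero).clm_apply continuous_const

/-- Ladyzhenskaya's inequality on the unit square. -/
lemma ladyzhenskaya_unitSquare {f : ℝ × ℝ → ℝ} (hf : ContDiff ℝ 1 f) :
    ∫ z in unitSquare, f z ^ 4 ≤ 2 * (∫ z in unitSquare, f z ^ 2) ^ 2 +
      4 * (∫ z in unitSquare, f z ^ 2) * ((∫ z in unitSquare, fderiv ℝ f z (1, 0) ^ 2) +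
        ∫ z in unitSquare, fderiv ℝ f z (0, 1) ^ 2) := by
  have hfc := hf.continuous
  have ha := continuous_fderiv_apply_const hf (1, 0)
  have hb := continuous_fderiv_apply_const hf (0, 1)
  set fa := fun z => fderiv ℝ f z (1, 0) with hfa
  set fb := fun z => fderiv ℝ f z (0, 1) with hfb
  have hca : Continuous fun z => f z ^ 2 + 2 * |f z * fa z| := by fun_prop
  have hcb : Continuous fun z => f z ^ 2 + 2 * |f z * fb z| := by fun_prop
  set α := fun b => ∫ a in (0:ℝ)..1, (f (a, b) ^ 2 + 2 * |f (a, b) * fa (a, b)|) with hα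
  set β := fun a => ∫ b in (0:ℝ)..1, (f (a, b) ^ 2 + 2 * |f (a, b) * fb (a, b)|) with hβ
  have hαc : Continuous α := continuous_integral_fst hca
  have hβc : Continuous β := continuous_integral_snd hcb
  have h1 : ∀ z ∈ unitSquare, f z ^ 4 ≤ β z.1 * α z.2 := by
    rintro ⟨a, b⟩ ⟨hza, hzb⟩
    have i1 : f (a, b) ^ 2 ≤ α b :=
      sq_le_integral_add (fun a => hasDerivAt_fst hf a b) (by fun_prop) hza
    have i2 : f (a, b) ^ 2 ≤ β a :=
      sq_le_integral_add (fun b => hasDerivAt_snd hf a b) (by fun_prop) hzb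
    have := mul_le_mul i2 i1 (sq_nonneg _) ((sq_nonneg _).trans i2)
    linarith [(by ring : f (a, b) ^ 4 = f (a, b) ^ 2 * f (a, b) ^ 2)]
  have h2 := integral_mono_unitSquare (by fun_prop) (by fun_prop) h1
  have h3 : ∫ z in unitSquare, β z.1 * α z.2 = (∫ a in (0:ℝ)..1, β a) * ∫ b in (0:ℝ)..1, α b := by
    rw [integral_unitSquare (by fun_prop)]
    simp
  have split : ∀ g : ℝ × ℝ → ℝ, Continuous g → ∫ z in unitSquare, (f z ^ 2 + 2 * |f z * g z|) =
      (∫ z in unitSquare, f z ^ 2) + 2 * ∫ z in unitSquare, |f z * g z| := by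
    intro g hg
    rw [integral_add (Continuous.integrableOn_unitSquare (by fun_prop))
      (Continuous.integrableOn_unitSquare (by fun_prop)), integral_const_mul]
  have cs : ∀ g : ℝ × ℝ → ℝ, Continuous g → (∫ z in unitSquare, |f z * g z|) ^ 2 ≤
      (∫ z in unitSquare, f z ^ 2) * ∫ z in unitSquare, g z ^ 2 := by
    intro g hg
    have := sq_integral_mul_le (μ := volume.restrict unitSquare) (f := fun z => |f z|)
      (g := fun z => |g z|) (Continuous.integrableOn_unitSquare (by fun_prop))
      (Continuous.integrableOn_unitSquare (by fun_prop))
      (Continuous.integrableOn_unitSquare (by fun_prop))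
    simpa only [abs_mul, sq_abs] using this
  have h4 : ∫ a in (0:ℝ)..1, β a = (∫ z in unitSquare, f z ^ 2) +
      2 * ∫ z in unitSquare, |f z * fb z| := by
    rw [← split fb hb, integral_unitSquare hcb]
  have h5 : ∫ b in (0:ℝ)..1, α b = (∫ z in unitSquare, f z ^ 2) +
      2 * ∫ z in unitSquare, |f z * fa z| := by
    rw [← split fa ha, integral_unitSquare' hca]
  rw [h3, h4, h5] at h2
  have c1 := cs fa ha
  have c2 := cs fb hb
  refine h2.trans ?_
  set F := ∫ z in unitSquare, f z ^ 2
  set X := ∫ z in unitSquare, |f z * fa z|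
  set Y := ∫ z in unitSquare, |f z * fb z|
  nlinarith [sq_nonneg (X - Y), sq_nonneg (F - 2 * X), sq_nonneg (F - 2 * Y)]

/-- The Poincaré inequality on the unit square. -/
lemma poincare_unitSquare {f : ℝ × ℝ → ℝ} (hf : ContDiff ℝ 1 f)
    (h0 : ∫ z in unitSquare, f z = 0) :
    ∫ z in unitSquare, f z ^ 2 ≤ 2 * ((∫ z in unitSquare, fderiv ℝ f z (1, 0) ^ 2) +
        ∫ z in unitSquare, fderiv ℝ f z (0, 1) ^ 2) := by
  have hfc := hf.continuous
  have ha := continuous_fderiv_apply_const hf (1, 0)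
  have hb := continuous_fderiv_apply_const hf (0, 1)
  set A := fun b => ∫ a in (0:ℝ)..1, fderiv ℝ f (a, b) (1, 0) ^ 2 with hA
  set B := fun a => ∫ b in (0:ℝ)..1, fderiv ℝ f (a, b) (0, 1) ^ 2 with hB
  have hAc : Continuous A := continuous_integral_fst (f := fun z => fderiv ℝ f z (1, 0) ^ 2)
    (by fun_prop)
  have hBc : Continuous B := continuous_integral_snd (f := fun z => fderiv ℝ f z (0, 1) ^ 2)
    (by fun_prop)
  have key : ∀ z ∈ unitSquare, ∀ z' ∈ unitSquare, (f z - f z') ^ 2 ≤ 2 * A z.2 + 2 * B z'.1 := by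
    rintro ⟨a, b⟩ ⟨hza, hzb⟩ ⟨a', b'⟩ ⟨hza', hzb'⟩
    have i1 : (f (a, b) - f (a', b)) ^ 2 ≤ A b :=
      sub_sq_le_integral_sq_deriv (fun a => hasDerivAt_fst hf a b) (by fun_prop) hza hza'
    have i2 : (f (a', b) - f (a', b')) ^ 2 ≤ B a' :=
      sub_sq_le_integral_sq_deriv (fun b => hasDerivAt_snd hf a' b) (by fun_prop) hzb hzb'
    simp only
    nlinarith [sq_nonneg ((f (a, b) - f (a', b)) - (f (a', b) - f (a', b')))]
  have hAi : ∫ z in unitSquare, A z.2 = ∫ z in unitSquare, fderiv ℝ f z (1, 0) ^ 2 := by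
    rw [integral_unitSquare' (by fun_prop), integral_unitSquare' (by fun_prop)]; simp [hA]
  have hBi : ∫ z in unitSquare, B z.1 = ∫ z in unitSquare, fderiv ℝ f z (0, 1) ^ 2 := by
    rw [integral_unitSquare (by fun_prop), integral_unitSquare (by fun_prop)]; simp [hB]
  have step : ∀ z' ∈ unitSquare, ∫ z in unitSquare, f z ^ 2 ≤
      2 * (∫ z in unitSquare, A z.2) + 2 * B z'.1 := by
    intro z' hz'
    have h := integral_mono_unitSquare (by fun_prop) (by fun_prop) fun z hz => key z hz z' hz'
    have e1 : (fun z => (f z - f z') ^ 2) = fun z => (f z ^ 2 - (2 * f z') * f z) + f z' ^ 2 := by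
      funext z; ring
    rw [e1, integral_add (Continuous.integrableOn_unitSquare (by fun_prop))
      (Continuous.integrableOn_unitSquare (by fun_prop)),
      integral_sub (Continuous.integrableOn_unitSquare (by fun_prop))
      (Continuous.integrableOn_unitSquare (by fun_prop)), integral_const_mul, h0,
      integral_add (Continuous.integrableOn_unitSquare (by fun_prop))
      (Continuous.integrableOn_unitSquare (by fun_prop)), integral_const_mul] at h
    simp at h
    nlinarith [sq_nonneg (f z')]
  have h := integral_mono_unitSquare (by fun_prop) (by fun_prop) step
  rw [integral_add (Continuous.integrableOn_unitSquare (by fun_prop))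
      (Continuous.integrableOn_unitSquare (by fun_prop)), integral_const_mul (2:ℝ) fun z : ℝ × ℝ => B z.1, hBi, hAi] at h
  simp at h
  linarith

/-- Periodicity with respect to `ℤ²`. -/
def IntPeriodic (k : ℝ × ℝ → ℝ) : Prop :=
  ∀ z, k (z + (1, 0)) = k z ∧ k (z + (0, 1)) = k z

lemma IntPeriodic.fderiv_apply {k : ℝ × ℝ → ℝ} (hk : IntPeriodic k) (e : ℝ × ℝ) :
    IntPeriodic fun z => fderiv ℝ k z e := by
  intro z
  constructor
  · have : (fun z => k (z + (1, 0))) = k := funext fun z => (hk z).1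
    simp only
    rw [← fderiv_comp_add_right, this]
  · have : (fun z => k (z + (0, 1))) = k := funext fun z => (hk z).2
    simp only
    rw [← fderiv_comp_add_right, this]

lemma integral_fderiv_apply_eq_zero {k : ℝ × ℝ → ℝ} (hk : ContDiff ℝ 1 k) (hp : IntPeriodic k)
    (e : ℝ × ℝ) : ∫ z in unitSquare, fderiv ℝ k z e = 0 := by
  have ha := continuous_fderiv_apply_const hk (1, 0)
  have hb := continuous_fderiv_apply_const hk (0, 1)
  have h1 : ∫ z in unitSquare, fderiv ℝ k z (1, 0) = 0 := by
    rw [integral_unitSquare' ha]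
    refine (intervalIntegral.integral_congr (g := fun _ => 0) fun b _ => ?_).trans (by simp)
    simp only
    rw [intervalIntegral.integral_eq_sub_of_hasDerivAt (fun a _ => hasDerivAt_fst hk a b)
      (Continuous.intervalIntegrable (by fun_prop) _ _)]
    have := (hp (0, b)).1
    simp only [Prod.mk_add_mk, zero_add, add_zero] at this
    rw [this, sub_self]
  have h2 : ∫ z in unitSquare, fderiv ℝ k z (0, 1) = 0 := by
    rw [integral_unitSquare hb]
    refine (intervalIntegral.integral_congr (g := fun _ => 0) fun a _ => ?_).trans (by simp)
    simp only
    rw [intervalIntegral.integral_eq_sub_of_hasDerivAt (fun b _ => hasDerivAt_snd hk a b)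
      (Continuous.intervalIntegrable (by fun_prop) _ _)]
    have := (hp (a, 0)).2
    simp only [Prod.mk_add_mk, zero_add, add_zero] at this
    rw [this, sub_self]
  have e1 : ∀ z, fderiv ℝ k z e = e.1 * fderiv ℝ k z (1, 0) + e.2 * fderiv ℝ k z (0, 1) := by
    intro z
    have : e = e.1 • ((1:ℝ), (0:ℝ)) + e.2 • ((0:ℝ), (1:ℝ)) := by ext <;> simp
    conv_lhs => rw [this]
    rw [map_add, map_smul, map_smul, smul_eq_mul, smul_eq_mul]
  simp only [e1]
  rw [integral_add (Continuous.integrableOn_unitSquare (by fun_prop))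
    (Continuous.integrableOn_unitSquare (by fun_prop)), integral_const_mul, integral_const_mul,
    h1, h2]
  simp

lemma ContDiff.fderiv_apply_const {u : ℝ × ℝ → ℝ} (hu : ContDiff ℝ 2 u) (e : ℝ × ℝ) :
    ContDiff ℝ 1 fun z => fderiv ℝ u z e :=
  (hu.fderiv_right (m := 1) (by norm_num)).clm_apply contDiff_const

/-- Integration by parts on the torus. -/
lemma integral_comp_mul_fderiv_fderiv {u : ℝ × ℝ → ℝ} (hu : ContDiff ℝ 2 u) (hp : IntPeriodic u)
    {Ψ Ψ' : ℝ → ℝ} (hΨ : ∀ x, HasDerivAt Ψ (Ψ' x) x) (hΨ' : Continuous Ψ') (e : ℝ × ℝ) :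
    ∫ z in unitSquare, Ψ (u z) * fderiv ℝ (fun z => fderiv ℝ u z e) z e =
      -∫ z in unitSquare, Ψ' (u z) * fderiv ℝ u z e ^ 2 := by
  have hu1 : ContDiff ℝ 1 u := hu.of_le (by norm_num)
  have huc := hu.continuous
  have hd := hu.fderiv_apply_const e
  have hΨc : ContDiff ℝ 1 Ψ := by
    rw [contDiff_one_iff_deriv]
    refine ⟨fun x => (hΨ x).differentiableAt, ?_⟩
    rwa [show deriv Ψ = Ψ' from funext fun x => (hΨ x).deriv]
  have hk : ContDiff ℝ 1 fun z => Ψ (u z) * fderiv ℝ u z e := (hΨc.comp hu1).mul hd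
  have hkp : IntPeriodic fun z => Ψ (u z) * fderiv ℝ u z e := by
    intro z
    have h1 := hp z
    have h2 := hp.fderiv_apply e z
    simp only at h2 ⊢
    rw [h1.1, h1.2, h2.1, h2.2]
    exact ⟨rfl, rfl⟩
  have hfd : ∀ z, fderiv ℝ (fun z => Ψ (u z) * fderiv ℝ u z e) z e =
      Ψ (u z) * fderiv ℝ (fun z => fderiv ℝ u z e) z e + Ψ' (u z) * fderiv ℝ u z e ^ 2 := by
    intro z
    have h1 : HasFDerivAt (fun z => Ψ (u z)) (Ψ' (u z) • fderiv ℝ u z) z :=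
      (hΨ (u z)).comp_hasFDerivAt z (hu1.differentiable one_ne_zero z).hasFDerivAt
    have h2 := (hd.differentiable one_ne_zero z).hasFDerivAt
    rw [show fderiv ℝ (fun z => Ψ (u z) * fderiv ℝ u z e) z = _ from (h1.mul h2).fderiv]
    simp only [add_apply, smul_apply, smul_eq_mul]
    ring
  have h0 := integral_fderiv_apply_eq_zero hk hkp e
  have hc1 := continuous_fderiv_apply_const hd e
  have hc2 := hd.continuous
  have hc3 := hΨc.continuous
  simp only [hfd] at h0
  rw [integral_add (Continuous.integrableOn_unitSquare (by fun_prop))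
    (Continuous.integrableOn_unitSquare (by fun_prop))] at h0
  linarith

/-- Differentiation under the integral over the unit square. -/
lemma hasDerivAt_integral_unitSquare {f f' : ℝ → ℝ × ℝ → ℝ} {a b : ℝ}
    (hf : ∀ s ∈ Set.Ioo a b, ∀ z, HasDerivAt (fun s => f s z) (f' s z) s)
    (hfc : ∀ s ∈ Set.Ioo a b, Continuous (f s))
    (hf'c : ContinuousOn (fun p : ℝ × ℝ × ℝ => f' p.1 p.2) (Set.Ioo a b ×ˢ Set.univ))
    {s : ℝ} (hs : s ∈ Set.Ioo a b) :
    HasDerivAt (fun s => ∫ z in unitSquare, f s z) (∫ z in unitSquare, f' s z) s := by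
  obtain ⟨ε, hε, hball⟩ := Metric.nhds_basis_closedBall.mem_iff.1 (Ioo_mem_nhds hs.1 hs.2)
  have hcomp : IsCompact (Metric.closedBall s ε ×ˢ unitSquare) :=
    (isCompact_closedBall s ε).prod isCompact_unitSquare
  obtain ⟨M, hM⟩ := hcomp.exists_bound_of_continuousOn
    (hf'c.mono (Set.prod_mono hball (Set.subset_univ _)))
  have hms : MeasurableSet unitSquare := isCompact_unitSquare.measurableSet
  have hf's : Continuous (f' s) := by
    rw [continuous_iff_continuousAt]
    intro z
    have h1 : ContinuousAt (fun p : ℝ × ℝ × ℝ => f' p.1 p.2) (s, z) :=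
      hf'c.continuousAt (prod_mem_nhds (Ioo_mem_nhds hs.1 hs.2) Filter.univ_mem)
    exact h1.comp (f := fun z => (s, z)) (by fun_prop)
  refine (hasDerivAt_integral_of_dominated_loc_of_deriv_le (bound := fun _ => M)
    (Metric.ball_mem_nhds s hε) ?_ (hfc s hs).integrableOn_unitSquare
    hf's.aestronglyMeasurable ?_ (integrable_const M) ?_).2
  · filter_upwards [Ioo_mem_nhds hs.1 hs.2] with x hx using (hfc x hx).aestronglyMeasurable
  · rw [ae_restrict_iff' hms]
    exact Filter.Eventually.of_forall fun z hz x hx =>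
      hM (x, z) ⟨Metric.ball_subset_closedBall hx, hz⟩
  · exact Filter.Eventually.of_forall fun z x hx => hf x (hball (Metric.ball_subset_closedBall hx)) z

/-- Bounds on all the norms `L^{2^n}` give a pointwise bound. -/
lemma le_of_integral_pow_le {f : ℝ × ℝ → ℝ} (hf : Continuous f) (hf0 : ∀ z, 0 ≤ f z) {X : ℝ}
    (h : ∀ n : ℕ, ∫ z in unitSquare, f z ^ 2 ^ n ≤ X ^ 2 ^ n) :
    ∀ z ∈ unitSquare, f z ≤ X := by
  have hX : 0 ≤ X := by
    have h0 := h 0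
    simp only [pow_zero, pow_one] at h0
    exact (integral_nonneg fun z => hf0 z).trans h0
  intro z hz
  by_contra! hlt
  obtain ⟨Y, hXY, hY⟩ := exists_between hlt
  have hY0 : 0 < Y := hX.trans_lt hXY
  set U := {z | Y < f z} with hU
  have hUo : IsOpen U := isOpen_lt continuous_const hf
  have hcl : z ∈ closure (Set.Ioo (0:ℝ) 1 ×ˢ Set.Ioo (0:ℝ) 1) := by
    rw [closure_prod_eq, closure_Ioo zero_ne_one]; exact hz
  obtain ⟨y, hyU, hy⟩ := mem_closure_iff.1 hcl U hUo hY
  set V := U ∩ (Set.Ioo (0:ℝ) 1 ×ˢ Set.Ioo (0:ℝ) 1) with hV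
  have hVo : IsOpen V := hUo.inter (isOpen_Ioo.prod isOpen_Ioo)
  have hVs : V ⊆ unitSquare := fun p hp => ⟨⟨hp.2.1.1.le, hp.2.1.2.le⟩, hp.2.2.1.le, hp.2.2.2.le⟩
  have hpos : 0 < volume V := hVo.measure_pos _ ⟨y, hyU, hy⟩
  have hfin : volume V ≠ ⊤ := ((measure_mono hVs).trans_lt
    (by rw [volume_unitSquare]; exact ENNReal.one_lt_top)).ne
  have hc : 0 < volume.real V := ENNReal.toReal_pos hpos.ne' hfin
  have hb : ∀ n : ℕ, volume.real V ≤ (X / Y) ^ 2 ^ n := by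
    intro n
    have hi : IntegrableOn (fun z => f z ^ 2 ^ n) unitSquare :=
      Continuous.integrableOn_unitSquare (by fun_prop)
    have h1 : ∫ _ in V, Y ^ 2 ^ n ≤ ∫ z in V, f z ^ 2 ^ n := by
      refine setIntegral_mono_on (integrableOn_const hfin) (hi.mono_set hVs) hVo.measurableSet ?_
      intro p hp
      exact pow_le_pow_left₀ hY0.le (le_of_lt hp.1) _
    have h2 : ∫ z in V, f z ^ 2 ^ n ≤ ∫ z in unitSquare, f z ^ 2 ^ n :=
      setIntegral_mono_set hi (Filter.Eventually.of_forall fun z => pow_nonneg (hf0 z) _)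
        (Filter.Eventually.of_forall hVs)
    rw [setIntegral_const, smul_eq_mul] at h1
    rw [div_pow, le_div_iff₀ (by positivity)]
    exact h1.trans (h2.trans (h n))
  have hr : X / Y < 1 := (div_lt_one hY0).2 hXY
  have hlim : Filter.Tendsto (fun n : ℕ => (X / Y) ^ 2 ^ n) Filter.atTop (nhds 0) :=
    (tendsto_pow_atTop_nhds_zero_of_lt_one (by positivity) hr).comp
      (Filter.tendsto_atTop_mono (fun n => (Nat.lt_two_pow_self).le) Filter.tendsto_id)
  have := ge_of_tendsto' hlim hb
  linarith

lemma slice_energy_le {u : ℝ × ℝ → ℝ} (hu : ContDiff ℝ 2 u) (hp : IntPeriodic u) {M : ℝ}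
    (hM : ∀ z, |u z| ≤ M) (m : ℕ) (e : ℝ × ℝ) :
    exp (-M) * ∫ z in unitSquare, fderiv ℝ (fun z => (exp (u z) - 1) ^ (m + 1)) z e ^ 2 ≤
      -∫ z in unitSquare, ((2 * m + 2) * (exp (u z) - 1) ^ (2 * m + 1)) *
        fderiv ℝ (fun z => fderiv ℝ u z e) z e := by
  have hu1 : ContDiff ℝ 1 u := hu.of_le (by norm_num)
  have huc := hu.continuous
  have hd := continuous_fderiv_apply_const hu1 e
  have hΨ : ∀ x : ℝ, HasDerivAt (fun x => (2 * m + 2) * (exp x - 1) ^ (2 * m + 1))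
      ((2 * m + 2) * ((2 * m + 1) * (exp x - 1) ^ (2 * m) * exp x)) x := fun x =>
    ((((hasDerivAt_exp x).sub_const 1).fun_pow (2 * m + 1)).const_mul _).congr_deriv
      (by push_cast; simp)
  rw [integral_comp_mul_fderiv_fderiv hu hp hΨ (by fun_prop) e, neg_neg]
  have hf : ∀ z, fderiv ℝ (fun z => (exp (u z) - 1) ^ (m + 1)) z e =
      (m + 1) * (exp (u z) - 1) ^ m * exp (u z) * fderiv ℝ u z e := by
    intro z
    have h1 : HasDerivAt (fun x => (exp x - 1) ^ (m + 1))
        ((m + 1) * (exp (u z) - 1) ^ m * exp (u z)) (u z) :=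
      (((hasDerivAt_exp (u z)).sub_const 1).fun_pow (m + 1)).congr_deriv (by push_cast; simp)
    have h2 := h1.comp_hasFDerivAt z (hu1.differentiable one_ne_zero z).hasFDerivAt
    rw [show fderiv ℝ (fun z => (exp (u z) - 1) ^ (m + 1)) z = _ from h2.fderiv]
    simp only [smul_apply, smul_eq_mul]
  simp only [hf]
  rw [← integral_const_mul]
  refine integral_mono_unitSquare (by fun_prop) (by fun_prop) fun z _ => ?_
  have h1 : exp (-M) * exp (u z) ≤ 1 := by
    rw [← exp_add, exp_le_one_iff]
    linarith [le_abs_self (u z), hM z]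
  have h2 : ((m:ℝ) + 1) ^ 2 ≤ (2 * m + 2) * (2 * m + 1) := by
    have : (0:ℝ) ≤ m := m.cast_nonneg
    nlinarith
  have h3 : 0 ≤ ((exp (u z) - 1) ^ m) ^ 2 * exp (u z) * fderiv ℝ u z e ^ 2 := by positivity
  calc exp (-M) * ((m + 1) * (exp (u z) - 1) ^ m * exp (u z) * fderiv ℝ u z e) ^ 2
      = ((exp (-M) * exp (u z)) * ((m:ℝ) + 1) ^ 2) *
        (((exp (u z) - 1) ^ m) ^ 2 * exp (u z) * fderiv ℝ u z e ^ 2) := by ring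
    _ ≤ (1 * ((2 * m + 2) * (2 * m + 1))) *
        (((exp (u z) - 1) ^ m) ^ 2 * exp (u z) * fderiv ℝ u z e ^ 2) := by gcongr
    _ = _ := by ring

lemma integral_fderiv_sq_le {f : ℝ × ℝ → ℝ} (hf : ContDiff ℝ 1 f) {e₁ e₂ e : ℝ × ℝ} {a b : ℝ}
    (he : e = a • e₁ + b • e₂) :
    ∫ z in unitSquare, fderiv ℝ f z e ^ 2 ≤ (a ^ 2 + b ^ 2) *
      ((∫ z in unitSquare, fderiv ℝ f z e₁ ^ 2) + ∫ z in unitSquare, fderiv ℝ f z e₂ ^ 2) := by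
  have h := continuous_fderiv_apply_const hf
  have h1 := h e₁
  have h2 := h e₂
  have h3 := h e
  rw [← integral_add (Continuous.integrableOn_unitSquare (by fun_prop))
    (Continuous.integrableOn_unitSquare (by fun_prop)), ← integral_const_mul]
  refine integral_mono_unitSquare (by fun_prop) (by fun_prop) fun z _ => ?_
  rw [he, map_add, map_smul, map_smul, smul_eq_mul, smul_eq_mul]
  nlinarith [sq_nonneg (a * fderiv ℝ f z e₂ - b * fderiv ℝ f z e₁)]

/-- Solutions on a cusp cylinder over the torus of a quasilinear equation
`∂(P ∂e^u) + Q Δu = 0` with `P ~ s⁴`, `Q ~ s`, bounded and normalised by `∫ e^u = 1`, decay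
like `exp (-δ / √s)`. -/
theorem cusp_decay {u ws wss : ℝ → ℝ × ℝ → ℝ} {P P' Q : ℝ → ℝ} {L k q M : ℝ} {e₁ e₂ : ℝ × ℝ}
    {a b c d : ℝ} (hL : 0 < L) (hk : 0 < k) (hq : 0 < q)
    (hP : ∀ s ∈ Set.Ioo 0 L, 0 < P s ∧ P s ≤ k * s ^ 4)
    (hP' : ∀ s ∈ Set.Ioo 0 L, HasDerivAt P (P' s) s ∧ |P' s| ≤ k * s ^ 3)
    (hQ : ∀ s ∈ Set.Ioo 0 L, q * s ≤ Q s)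
    (he₁ : (1, 0) = a • e₁ + b • e₂) (he₂ : (0, 1) = c • e₁ + d • e₂)
    (hu : ∀ s ∈ Set.Ioo 0 L, ContDiff ℝ 2 (u s))
    (hper : ∀ s ∈ Set.Ioo 0 L, IntPeriodic (u s))
    (hM : ∀ s ∈ Set.Ioo 0 L, ∀ z, |u s z| ≤ M)
    (hws : ∀ s ∈ Set.Ioo 0 L, ∀ z, HasDerivAt (fun s => exp (u s z)) (ws s z) s)
    (hwss : ∀ s ∈ Set.Ioo 0 L, ∀ z, HasDerivAt (fun s => ws s z) (wss s z) s)
    (cu : ContinuousOn (fun p : ℝ × ℝ × ℝ => u p.1 p.2) (Set.Ioo 0 L ×ˢ Set.univ))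
    (cws : ContinuousOn (fun p : ℝ × ℝ × ℝ => ws p.1 p.2) (Set.Ioo 0 L ×ˢ Set.univ))
    (cwss : ContinuousOn (fun p : ℝ × ℝ × ℝ => wss p.1 p.2) (Set.Ioo 0 L ×ˢ Set.univ))
    (hmean : ∀ s ∈ Set.Ioo 0 L, ∫ z in unitSquare, exp (u s z) = 1)
    (hpde : ∀ s ∈ Set.Ioo 0 L, ∀ z, P s * wss s z + P' s * ws s z +
      Q s * (fderiv ℝ (fun z => fderiv ℝ (u s) z e₁) z e₁ +
        fderiv ℝ (fun z => fderiv ℝ (u s) z e₂) z e₂) = 0) :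
    ∃ C > (0:ℝ), ∃ δ > (0:ℝ), ∀ s, 0 < s → s ≤ L / 4 → ∀ z ∈ unitSquare,
      |u s z| ≤ C * exp (-δ * (√s)⁻¹) := by
  have slice : ∀ {f : ℝ → ℝ × ℝ → ℝ},
      ContinuousOn (fun p : ℝ × ℝ × ℝ => f p.1 p.2) (Set.Ioo 0 L ×ˢ Set.univ) →
      ∀ s ∈ Set.Ioo 0 L, Continuous (f s) := by
    intro f hf s hs
    exact hf.comp_continuous (f := fun z => (s, z)) (by fun_prop) fun z => ⟨hs, trivial⟩
  set κ := (a ^ 2 + b ^ 2 + c ^ 2 + d ^ 2) * exp M / q with hκ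
  have habcd : 0 < a ^ 2 + b ^ 2 + c ^ 2 + d ^ 2 := by
    by_contra! hle
    have ha : a = 0 := by nlinarith [sq_nonneg a, sq_nonneg b, sq_nonneg c, sq_nonneg d]
    have hb : b = 0 := by nlinarith [sq_nonneg a, sq_nonneg b, sq_nonneg c, sq_nonneg d]
    have := congrArg Prod.fst he₁
    simp [ha, hb] at this
  have hκ0 : 0 < κ := by positivity
  -- the energies `∫ w ^ (2m+2)` and their first two derivatives
  set F : ℕ → ℝ → ℝ := fun m s => ∫ z in unitSquare, (exp (u s z) - 1) ^ (2 * m + 2) with hF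
  set F' : ℕ → ℝ → ℝ := fun m s => ∫ z in unitSquare,
    (2 * m + 2) * (exp (u s z) - 1) ^ (2 * m + 1) * ws s z with hF'
  set F'' : ℕ → ℝ → ℝ := fun m s => ∫ z in unitSquare,
    ((2 * m + 2) * ((2 * m + 1) * (exp (u s z) - 1) ^ (2 * m) * ws s z) * ws s z +
      (2 * m + 2) * (exp (u s z) - 1) ^ (2 * m + 1) * wss s z) with hF''
  set R : ℕ → ℝ → ℝ := fun m s => P' s * F' m s + P s * F'' m s with hR
  have dF : ∀ m, ∀ s ∈ Set.Ioo 0 L, HasDerivAt (F m) (F' m s) s := by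
    intro m s hs
    refine hasDerivAt_integral_unitSquare (f := fun s z => (exp (u s z) - 1) ^ (2 * m + 2))
      (f' := fun s z => (2 * m + 2) * (exp (u s z) - 1) ^ (2 * m + 1) * ws s z) ?_ ?_ ?_ hs
    · intro s hs z
      exact (((hws s hs z).sub_const 1).fun_pow (2 * m + 2)).congr_deriv (by push_cast; simp)
    · intro s hs
      have := slice cu s hs
      fun_prop
    · fun_prop
  have dF' : ∀ m, ∀ s ∈ Set.Ioo 0 L, HasDerivAt (F' m) (F'' m s) s := by
    intro m s hs
    refine hasDerivAt_integral_unitSquare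
      (f := fun s z => (2 * m + 2) * (exp (u s z) - 1) ^ (2 * m + 1) * ws s z)
      (f' := fun s z => (2 * m + 2) * ((2 * m + 1) * (exp (u s z) - 1) ^ (2 * m) * ws s z) * ws s z +
      (2 * m + 2) * (exp (u s z) - 1) ^ (2 * m + 1) * wss s z) ?_ ?_ ?_ hs
    · intro s hs z
      have h1 := (((hws s hs z).sub_const 1).fun_pow (2 * m + 1)).const_mul (2 * (m:ℝ) + 2)
      exact (h1.mul (hwss s hs z)).congr_deriv (by push_cast; simp)
    · intro s hs
      have := slice cu s hs
      have := slice cws s hs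
      fun_prop
    · fun_prop
  have dK : ∀ m, ∀ s ∈ Set.Ioo 0 L, HasDerivAt (fun s => P s * F' m s) (R m s) s :=
    fun m s hs => (hP' s hs).1.mul (dF' m s hs)
  have coercive : ∀ m : ℕ, ∀ s ∈ Set.Ioo 0 L,
      (∫ z in unitSquare, fderiv ℝ (fun z => (exp (u s z) - 1) ^ (m + 1)) z (1, 0) ^ 2) +
        (∫ z in unitSquare, fderiv ℝ (fun z => (exp (u s z) - 1) ^ (m + 1)) z (0, 1) ^ 2) ≤
      κ * (R m s / s) := by
    intro m s hs
    have hs0 := hs.1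
    have cus := slice cu s hs
    have cwss' := slice cwss s hs
    have cws' := slice cws s hs
    have hD1 := continuous_fderiv_apply_const ((hu s hs).fderiv_apply_const e₁) e₁
    have hD2 := continuous_fderiv_apply_const ((hu s hs).fderiv_apply_const e₂) e₂
    have hf1 : ContDiff ℝ 1 fun z => (exp (u s z) - 1) ^ (m + 1) :=
      (((hu s hs).of_le (by norm_num)).exp.sub contDiff_const).pow _
    have s1 := slice_energy_le (hu s hs) (hper s hs) (hM s hs) m e₁
    have s2 := slice_energy_le (hu s hs) (hper s hs) (hM s hs) m e₂
    have t1 := integral_fderiv_sq_le hf1 he₁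
    have t2 := integral_fderiv_sq_le hf1 he₂
    set G1 := ∫ z in unitSquare, fderiv ℝ (fun z => (exp (u s z) - 1) ^ (m + 1)) z e₁ ^ 2
    set G2 := ∫ z in unitSquare, fderiv ℝ (fun z => (exp (u s z) - 1) ^ (m + 1)) z e₂ ^ 2
    set J1 := ∫ z in unitSquare, ((2 * m + 2) * (exp (u s z) - 1) ^ (2 * m + 1)) *
        fderiv ℝ (fun z => fderiv ℝ (u s) z e₁) z e₁ with hJ1
    set J2 := ∫ z in unitSquare, ((2 * m + 2) * (exp (u s z) - 1) ^ (2 * m + 1)) *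
        fderiv ℝ (fun z => fderiv ℝ (u s) z e₂) z e₂ with hJ2
    have hG1 : 0 ≤ G1 := integral_nonneg fun z => sq_nonneg _
    have hG2 : 0 ≤ G2 := integral_nonneg fun z => sq_nonneg _
    have hRJ : -(Q s * (J1 + J2)) ≤ R m s := by
      have e1 : R m s + Q s * (J1 + J2) = ∫ z in unitSquare,
          P s * ((2 * m + 2) * ((2 * m + 1) * (exp (u s z) - 1) ^ (2 * m) * ws s z) * ws s z) := by
        rw [hR, hJ1, hJ2]
        simp only [hF', hF'']
        rw [← integral_const_mul, ← integral_const_mul,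
          ← integral_add (Continuous.integrableOn_unitSquare (by fun_prop))
            (Continuous.integrableOn_unitSquare (by fun_prop)),
          ← integral_add (Continuous.integrableOn_unitSquare (by fun_prop))
            (Continuous.integrableOn_unitSquare (by fun_prop)), ← integral_const_mul,
          ← integral_add (Continuous.integrableOn_unitSquare (by fun_prop))
            (Continuous.integrableOn_unitSquare (by fun_prop))]
        congr 1
        funext z
        linear_combination ((2 * m + 2) * (exp (u s z) - 1) ^ (2 * m + 1)) * hpde s hs z
      have e2 : 0 ≤ ∫ z in unitSquare,
          P s * ((2 * m + 2) * ((2 * m + 1) * (exp (u s z) - 1) ^ (2 * m) * ws s z) * ws s z) := by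
        refine integral_nonneg fun z => ?_
        have h1 := (hP s hs).1.le
        have h2 : 0 ≤ (exp (u s z) - 1) ^ (2 * m) := by rw [pow_mul]; positivity
        have h3 := mul_self_nonneg (ws s z)
        calc (0:ℝ) ≤ P s * ((2 * m + 2) * ((2 * m + 1) * (exp (u s z) - 1) ^ (2 * m) *
              (ws s z * ws s z))) := by positivity
          _ = _ := by ring
      linarith
    have hG : q * s * (exp (-M) * (G1 + G2)) ≤ R m s := by
      have h1 : exp (-M) * (G1 + G2) ≤ -(J1 + J2) := by linarith
      have h0 : 0 ≤ exp (-M) * (G1 + G2) := by positivity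
      calc q * s * (exp (-M) * (G1 + G2)) ≤ Q s * (exp (-M) * (G1 + G2)) := by
            gcongr; exact hQ s hs
        _ ≤ Q s * (-(J1 + J2)) :=
          mul_le_mul_of_nonneg_left h1 ((by positivity : 0 ≤ q * s).trans (hQ s hs))
        _ ≤ R m s := by linarith
    have hG' : G1 + G2 ≤ exp M / q * (R m s / s) := by
      rw [div_mul_div_comm, le_div_iff₀ (by positivity)]
      have : exp M * exp (-M) = 1 := by rw [← exp_add]; simp
      calc (G1 + G2) * (q * s) = exp M * (q * s * (exp (-M) * (G1 + G2))) := by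
            linear_combination (-(G1 + G2) * q * s) * this
        _ ≤ _ := by gcongr
    calc _ ≤ (a ^ 2 + b ^ 2) * (G1 + G2) + (c ^ 2 + d ^ 2) * (G1 + G2) := add_le_add t1 t2
      _ = (a ^ 2 + b ^ 2 + c ^ 2 + d ^ 2) * (G1 + G2) := by ring
      _ ≤ (a ^ 2 + b ^ 2 + c ^ 2 + d ^ 2) * (exp M / q * (R m s / s)) := by gcongr
      _ = _ := by rw [hκ]; ring
  have hR0 : ∀ m, ∀ s ∈ Set.Ioo 0 L, 0 ≤ R m s := by
    intro m s hs
    have h1 := coercive m s hs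
    have h2 : 0 ≤ κ * (R m s / s) := le_trans (add_nonneg
      (integral_nonneg fun z => sq_nonneg _) (integral_nonneg fun z => sq_nonneg _)) h1
    have h3 : 0 ≤ R m s / s := nonneg_of_mul_nonneg_right h2 hκ0
    have := mul_nonneg h3 hs.1.le
    rwa [div_mul_cancel₀ _ hs.1.ne'] at this
  have hwb : ∀ s ∈ Set.Ioo 0 L, ∀ z, |exp (u s z) - 1| ≤ exp M + 1 := by
    intro s hs z
    have h1 := exp_pos (u s z)
    have h2 : exp (u s z) ≤ exp M := exp_le_exp.2 ((le_abs_self _).trans (hM s hs z))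
    rw [abs_le]
    constructor <;> linarith [exp_pos M]
  have hFB : ∀ m, ∀ s ∈ Set.Ioo 0 L, 0 ≤ F m s ∧ F m s ≤ (exp M + 1) ^ (2 * m + 2) := by
    intro m s hs
    have cus := slice cu s hs
    have hev : Even (2 * m + 2) := ⟨m + 1, by ring⟩
    refine ⟨integral_nonneg fun z => hev.pow_nonneg _, ?_⟩
    have := integral_mono_unitSquare (f := fun z => (exp (u s z) - 1) ^ (2 * m + 2))
      (g := fun _ => (exp M + 1) ^ (2 * m + 2)) (by fun_prop) (by fun_prop) fun z _ => by
        rw [← hev.pow_abs]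
        exact pow_le_pow_left₀ (abs_nonneg _) (hwb s hs z) _
    simpa using this
  have hLady : ∀ m, ∀ s ∈ Set.Ioo 0 L,
      F (2 * m + 1) s ≤ (2 + 4 * κ) * (F m s * (R m s / s + F m s)) := by
    intro m s hs
    have hf1 : ContDiff ℝ 1 fun z => (exp (u s z) - 1) ^ (m + 1) :=
      (((hu s hs).of_le (by norm_num)).exp.sub contDiff_const).pow _
    have h1 := ladyzhenskaya_unitSquare hf1
    have e1 : ∀ z, ((exp (u s z) - 1) ^ (m + 1)) ^ 4 = (exp (u s z) - 1) ^ (2 * (2 * m + 1) + 2) :=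
      fun z => by rw [← pow_mul]; congr 1; ring
    have e2 : ∀ z, ((exp (u s z) - 1) ^ (m + 1)) ^ 2 = (exp (u s z) - 1) ^ (2 * m + 2) :=
      fun z => by rw [← pow_mul]; congr 1; ring
    simp only [e1, e2] at h1
    have h2 := coercive m s hs
    have h3 := (hFB m s hs).1
    have h4 : 0 ≤ R m s / s := div_nonneg (hR0 m s hs) hs.1.le
    have h5 := mul_le_mul_of_nonneg_left h2 h3
    have h6 := mul_nonneg h3 h4
    have h7 := mul_nonneg hκ0.le (mul_nonneg h3 h3)
    change F (2 * m + 1) s ≤ 2 * F m s ^ 2 + 4 * F m s * _ at h1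
    nlinarith
  have hPoinc : ∀ s ∈ Set.Ioo 0 L, 1 / (2 * κ) * s * F 0 s ≤ R 0 s := by
    intro s hs
    have hs0 := hs.1
    have cus := slice cu s hs
    have hf1 : ContDiff ℝ 1 fun z => (exp (u s z) - 1) :=
      (((hu s hs).of_le (by norm_num)).exp.sub contDiff_const)
    have h0 : ∫ z in unitSquare, (exp (u s z) - 1) = 0 := by
      rw [integral_sub (Continuous.integrableOn_unitSquare (by fun_prop))
        (Continuous.integrableOn_unitSquare (by fun_prop)), hmean s hs]
      simp
    have h1 := poincare_unitSquare hf1 h0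
    have h2 := coercive 0 s hs
    simp only [zero_add, pow_one] at h2
    have h3 : F 0 s ≤ 2 * κ * (R 0 s / s) := by
      have : F 0 s = ∫ z in unitSquare, (exp (u s z) - 1) ^ 2 := by simp [hF]
      rw [this]
      linarith
    calc 1 / (2 * κ) * s * F 0 s ≤ 1 / (2 * κ) * s * (2 * κ * (R 0 s / s)) := by gcongr
      _ = R 0 s := by field_simp
  obtain ⟨A, hA, δ, hδ, hdecay⟩ := exp_decay_of_bounded hL hk (by positivity) hP hP' (dF 0) (dK 0)
    hPoinc (fun s hs => (hFB 0 s hs).2)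
  have hidx : ∀ n : ℕ, 2 * (2 ^ n - 1) + 1 = 2 ^ (n + 1) - 1 := by
    intro n
    have : 1 ≤ 2 ^ n := Nat.one_le_two_pow
    rw [pow_succ]; omega
  obtain ⟨D, hD, hmoser⟩ := moser_iteration (F := fun n => F (2 ^ n - 1))
    (F' := fun n => F' (2 ^ n - 1)) (R := fun n => R (2 ^ n - 1)) (C := 2 + 4 * κ)
    (by linarith) hL hk hP (fun n => dF _) (fun n => dK _) (fun n => hR0 _) (fun n => hFB _)
    (fun n s hs => by have := hLady (2 ^ n - 1) s hs; rwa [hidx] at this)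
  simp only [pow_zero, Nat.sub_self] at hmoser
  have hD0 : 0 < D := by linarith
  refine ⟨exp M * √(D * A), by positivity, δ / (2 * √2), by positivity, fun s hs hsL z hz => ?_⟩
  have hsI : s ∈ Set.Ioo 0 L := ⟨hs, by linarith⟩
  have cus := slice cu s hsI
  have hsq : (exp (u s z) - 1) ^ 2 ≤ D * F 0 (2 * s) := by
    refine le_of_integral_pow_le (f := fun z => (exp (u s z) - 1) ^ 2) (by fun_prop)
      (fun z => sq_nonneg _) (fun n => ?_) z hz
    have h := hmoser s hs (by linarith) n
    have e : 2 * (2 ^ n - 1) + 2 = 2 * 2 ^ n := by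
      have : 1 ≤ 2 ^ n := Nat.one_le_two_pow
      omega
    simp only [hF, e, pow_mul] at h
    simpa [hF, pow_mul] using h
  have h2 := hdecay (2 * s) (by linarith) (by linarith)
  have hw : |exp (u s z) - 1| ≤ √(D * A) * exp (-(δ / (2 * √2)) * (√s)⁻¹) := by
    refine abs_le_of_sq_le_sq ?_ (by positivity)
    rw [mul_pow, Real.sq_sqrt (by positivity), ← exp_nat_mul]
    have e : ((2:ℕ):ℝ) * (-(δ / (2 * √2)) * (√s)⁻¹) = -δ * (√(2 * s))⁻¹ := by
      rw [Real.sqrt_mul (by norm_num)]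
      have : 0 < √s := Real.sqrt_pos.2 hs
      push_cast
      field_simp
    rw [e, mul_assoc]
    exact hsq.trans (by gcongr)
  have hlog : |u s z| ≤ exp M * |exp (u s z) - 1| := by
    have hb := abs_le.1 (hM s hsI z)
    have hM0 : 0 ≤ M := (abs_nonneg _).trans (hM s hsI z)
    have hM1 : 1 ≤ exp M := one_le_exp hM0
    have g1 := add_one_le_exp (u s z)
    have g2 := add_one_le_exp (-u s z)
    rcases le_total 0 (u s z) with h | h
    · rw [abs_of_nonneg h]
      have h3 : u s z ≤ |exp (u s z) - 1| := (by linarith : u s z ≤ exp (u s z) - 1).trans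
        (le_abs_self _)
      nlinarith [abs_nonneg (exp (u s z) - 1)]
    · rw [abs_of_nonpos h]
      have h3 : 1 - exp (u s z) ≤ |exp (u s z) - 1| := by
        rw [abs_sub_comm]; exact le_abs_self _
      have h4 : -u s z ≤ exp (-u s z) * (1 - exp (u s z)) := by
        have : exp (-u s z) * exp (u s z) = 1 := by rw [← exp_add]; simp
        linarith
      have h5 : exp (-u s z) ≤ exp M := exp_le_exp.2 (by linarith)
      have h6 : 0 ≤ 1 - exp (u s z) := by linarith [exp_le_one_iff.2 h]
      calc -u s z ≤ exp (-u s z) * (1 - exp (u s z)) := h4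
        _ ≤ exp M * (1 - exp (u s z)) := by gcongr
        _ ≤ _ := by gcongr
  calc |u s z| ≤ exp M * |exp (u s z) - 1| := hlog
    _ ≤ exp M * (√(D * A) * exp (-(δ / (2 * √2)) * (√s)⁻¹)) := by gcongr
    _ = _ := by ring

/-- Solutions of the ordinary differential equation `N h'' = 6 ξ² h' - 12 ξ h` satisfied by the
slice averages, written in the variable `s = ξ + c`. -/
lemma ode_solution_eq {H H' H'' : ℝ → ℝ} {c α : ℝ} (hc : 0 < c) (hc3 : c ^ 3 = 12)
    (hH : ∀ s ∈ Set.Ioo 0 c, HasDerivAt H (H' s) s)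
    (hH' : ∀ s ∈ Set.Ioo 0 c, HasDerivAt H' (H'' s) s)
    (hode : ∀ s ∈ Set.Ioo 0 c,
      (12 + (s - c) ^ 3) * H'' s = 6 * (s - c) ^ 2 * H' s - 12 * (s - c) * H s)
    (h0 : Filter.Tendsto H (nhdsWithin 0 (Set.Ioi 0)) (nhds 0))
    (hα : Filter.Tendsto H (nhdsWithin c (Set.Iio c)) (nhds α)) :
    ∀ s ∈ Set.Ioo 0 c, H s = α * (s ^ 3 * (2 * c - s) / c ^ 4) := by
  have hN : ∀ s ∈ Set.Ioo 0 c, 0 < 12 + (s - c) ^ 3 := by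
    intro s hs
    have h1 := hs.1
    have h2 := hs.2
    rw [← hc3]
    nlinarith [mul_pos h1 (mul_pos (sub_pos.2 h2) (by linarith : 0 < 2 * c - s)),
      mul_pos h1 (pow_pos hc 2)]
  have dξ : ∀ s, HasDerivAt (fun s => s - c) 1 s := fun s => (hasDerivAt_id s).sub_const c
  have key : ∀ {p p' p'' : ℝ → ℝ}, (∀ s, HasDerivAt p (p' s) s) → (∀ s, HasDerivAt p' (p'' s) s) →
      (∀ s, (12 + (s - c) ^ 3) * p'' s = 6 * (s - c) ^ 2 * p' s - 12 * (s - c) * p s) →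
      ∃ A, ∀ s ∈ Set.Ioo 0 c, H s * p' s - H' s * p s = A * (12 + (s - c) ^ 3) ^ 2 := by
    intro p p' p'' hp hp' hpode
    have hd : ∀ s ∈ Set.Ioo 0 c, HasDerivAt
        (fun s => (H s * p' s - H' s * p s) / (12 + (s - c) ^ 3) ^ 2) 0 s := by
      intro s hs
      have hNs := (hN s hs).ne'
      refine ((((hH s hs).fun_mul (hp' s)).fun_sub ((hH' s hs).fun_mul (hp s))).fun_div
        ((((dξ s).fun_pow 3).const_add 12).fun_pow 2) (pow_ne_zero _ hNs)).congr_deriv ?_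
      rw [div_eq_zero_iff]
      left
      push_cast
      linear_combination (12 + (s - c) ^ 3) * H s * hpode s -
        (12 + (s - c) ^ 3) * p s * hode s hs
    have hcst : ∀ s ∈ Set.Ioo 0 c, (H s * p' s - H' s * p s) / (12 + (s - c) ^ 3) ^ 2 =
        (H (c / 2) * p' (c / 2) - H' (c / 2) * p (c / 2)) / (12 + (c / 2 - c) ^ 3) ^ 2 := by
      intro s hs
      exact isOpen_Ioo.is_const_of_deriv_eq_zero isPreconnected_Ioo
        (fun s hs => (hd s hs).differentiableAt.differentiableWithinAt)
        (fun s hs => (hd s hs).deriv) hs ⟨by linarith, by linarith⟩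
    refine ⟨(H (c / 2) * p' (c / 2) - H' (c / 2) * p (c / 2)) / (12 + (c / 2 - c) ^ 3) ^ 2,
      fun s hs => ?_⟩
    rw [← hcst s hs, div_mul_cancel₀ _ (pow_ne_zero _ (hN s hs).ne')]
  obtain ⟨A, hA⟩ := key (p := fun s => 1 - (s - c) ^ 3 / 6) (p' := fun s => -(s - c) ^ 2 / 2)
    (p'' := fun s => -(s - c))
    (fun s => ((((dξ s).fun_pow 3).div_const 6).const_sub 1).congr_deriv (by push_cast; ring))
    (fun s => ((((dξ s).fun_pow 2).fun_neg).div_const 2).congr_deriv (by push_cast; ring))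
    (fun s => by ring)
  obtain ⟨B, hB⟩ := key (p := fun s => (s - c) - (s - c) ^ 4 / 24)
    (p' := fun s => 1 - (s - c) ^ 3 / 6) (p'' := fun s => -(s - c) ^ 2 / 2)
    (fun s => ((dξ s).fun_sub (((dξ s).fun_pow 4).div_const 24)).congr_deriv (by push_cast; ring))
    (fun s => ((((dξ s).fun_pow 3).div_const 6).const_sub 1).congr_deriv (by push_cast; ring))
    (fun s => by ring)
  have hsol : ∀ s ∈ Set.Ioo 0 c, H s =
      144 * (B * (1 - (s - c) ^ 3 / 6) - A * ((s - c) - (s - c) ^ 4 / 24)) := by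
    intro s hs
    refine mul_right_cancel₀ (pow_ne_zero 2 (hN s hs).ne') ?_
    linear_combination 144 * (1 - (s - c) ^ 3 / 6) * hB s hs -
      144 * ((s - c) - (s - c) ^ 4 / 24) * hA s hs
  have hcont : Continuous fun s : ℝ =>
    144 * (B * (1 - (s - c) ^ 3 / 6) - A * ((s - c) - (s - c) ^ 4 / 24)) := by fun_prop
  have e0 := tendsto_nhds_unique h0 ((hcont.tendsto 0).mono_left nhdsWithin_le_nhds |>.congr'
    (by
      filter_upwards [Ioo_mem_nhdsGT hc] with s hs using (hsol s hs).symm))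
  have eα := tendsto_nhds_unique hα ((hcont.tendsto c).mono_left nhdsWithin_le_nhds |>.congr'
    (by
      filter_upwards [Ioo_mem_nhdsLT hc] with s hs using (hsol s hs).symm))
  intro s hs
  rw [hsol s hs]
  have hB' : 144 * B = α := by rw [eα]; ring
  have hA' : A * c = -2 * B := by
    have : (0 - c) ^ 4 = 12 * c := by linear_combination c * hc3
    rw [this, show (0 - c) ^ 3 = -12 by linear_combination -hc3] at e0
    linarith
  rw [← hB']
  refine mul_left_cancel₀ hc.ne' ?_
  have hdiv : c * (s ^ 3 * (2 * c - s) / c ^ 4) = s ^ 3 * (2 * c - s) / 12 := by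
    rw [show c ^ 4 = 12 * c by linear_combination c * hc3]
    field_simp
  linear_combination (-144 * ((s - c) - (s - c) ^ 4 / 24)) * hA' - 144 * B * hdiv +
    12 * B * (c - 2 * s) * hc3

lemma IntPeriodic.apply_fract {k : ℝ × ℝ → ℝ} (hk : IntPeriodic k) (z : ℝ × ℝ) :
    k (Int.fract z.1, Int.fract z.2) = k z := by
  have h1 : ∀ b, Function.Periodic (fun a => k (a, b)) 1 := fun b a => by
    simpa using (hk (a, b)).1
  have h2 : ∀ a, Function.Periodic (fun b => k (a, b)) 1 := fun a b => by
    simpa using (hk (a, b)).2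
  have e1 := (h1 (Int.fract z.2)).sub_int_mul_eq (x := z.1) ⌊z.1⌋
  have e2 := (h2 z.1).sub_int_mul_eq (x := z.2) ⌊z.2⌋
  simp only [mul_one, Int.self_sub_floor] at e1 e2
  rw [e1, e2]

/-- Decay of torus-periodic solutions of the twisted Toda equation, in the variable
`s = ξ + c`, towards the logarithm of their slice averages. -/
theorem twistedToda_decay {V Y' Y'' : ℝ → ℝ × ℝ → ℝ} {c α M : ℝ} {e₁ e₂ : ℝ × ℝ}
    {a₁ b₁ a₂ b₂ : ℝ} (hc : 0 < c) (hc3 : c ^ 3 = 12) (hα : 0 < α)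
    (he₁ : (1, 0) = a₁ • e₁ + b₁ • e₂) (he₂ : (0, 1) = a₂ • e₁ + b₂ • e₂)
    (hV : ∀ s ∈ Set.Ioo 0 c, ContDiff ℝ 2 (V s))
    (hper : ∀ s ∈ Set.Ioo 0 c, IntPeriodic (V s))
    (hM : ∀ s ∈ Set.Ioo 0 c, ∀ z, |V s z - 3 * log s| ≤ M)
    (hY : ∀ s ∈ Set.Ioo 0 c, ∀ z, HasDerivAt (fun s => exp (V s z)) (Y' s z) s)
    (hY' : ∀ s ∈ Set.Ioo 0 c, ∀ z, HasDerivAt (fun s => Y' s z) (Y'' s z) s)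
    (cV : ContinuousOn (fun p : ℝ × ℝ × ℝ => V p.1 p.2) (Set.Ioo 0 c ×ˢ Set.univ))
    (cY' : ContinuousOn (fun p : ℝ × ℝ × ℝ => Y' p.1 p.2) (Set.Ioo 0 c ×ˢ Set.univ))
    (cY'' : ContinuousOn (fun p : ℝ × ℝ × ℝ => Y'' p.1 p.2) (Set.Ioo 0 c ×ˢ Set.univ))
    (hpde : ∀ s ∈ Set.Ioo 0 c, ∀ z, (12 + (s - c) ^ 3) * (Y'' s z +
      (fderiv ℝ (fun z => fderiv ℝ (V s) z e₁) z e₁ +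
        fderiv ℝ (fun z => fderiv ℝ (V s) z e₂) z e₂)) =
      6 * (s - c) ^ 2 * Y' s z - 12 * (s - c) * exp (V s z))
    (hlim : Filter.Tendsto (fun s => ∫ z in unitSquare, exp (V s z))
      (nhdsWithin c (Set.Iio c)) (nhds α)) :
    ∃ C > (0:ℝ), ∃ δ > (0:ℝ), ∀ s ∈ Set.Ioo 0 c, ∀ z,
      |V s z - log (α * (s ^ 3 * (2 * c - s) / c ^ 4))| ≤ C * exp (-δ * (√s)⁻¹) := by
  have slice : ∀ {f : ℝ → ℝ × ℝ → ℝ},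
      ContinuousOn (fun p : ℝ × ℝ × ℝ => f p.1 p.2) (Set.Ioo 0 c ×ˢ Set.univ) →
      ∀ s ∈ Set.Ioo 0 c, Continuous (f s) := by
    intro f hf s hs
    exact hf.comp_continuous (f := fun z => (s, z)) (by fun_prop) fun z => ⟨hs, trivial⟩
  -- the slice averages
  have hmean : ∀ s ∈ Set.Ioo 0 c,
      ∫ z in unitSquare, exp (V s z) = α * (s ^ 3 * (2 * c - s) / c ^ 4) := by
    refine ode_solution_eq hc hc3 (H' := fun s => ∫ z in unitSquare, Y' s z)
      (H'' := fun s => ∫ z in unitSquare, Y'' s z)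
      (fun s hs => hasDerivAt_integral_unitSquare (f := fun s z => exp (V s z)) hY
        (fun s hs => (hV s hs).continuous.rexp) cY' hs)
      (fun s hs => hasDerivAt_integral_unitSquare hY' (slice cY') cY'' hs) ?_ ?_ hlim
    · intro s hs
      have d₁ := (hV s hs).fderiv_apply_const e₁
      have d₂ := (hV s hs).fderiv_apply_const e₂
      have z₁ := integral_fderiv_apply_eq_zero d₁ ((hper s hs).fderiv_apply e₁) e₁
      have z₂ := integral_fderiv_apply_eq_zero d₂ ((hper s hs).fderiv_apply e₂) e₂
      have i₁ := (continuous_fderiv_apply_const d₁ e₁).integrableOn_unitSquare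
      have i₂ := (continuous_fderiv_apply_const d₂ e₂).integrableOn_unitSquare
      have i₁₂ : IntegrableOn (fun z => fderiv ℝ (fun z => fderiv ℝ (V s) z e₁) z e₁ +
          fderiv ℝ (fun z => fderiv ℝ (V s) z e₂) z e₂) unitSquare := ((continuous_fderiv_apply_const d₁ e₁).add
        (continuous_fderiv_apply_const d₂ e₂)).integrableOn_unitSquare
      have iY' := (slice cY' s hs).integrableOn_unitSquare
      have iY'' := (slice cY'' s hs).integrableOn_unitSquare
      have iY := (hV s hs).continuous.rexp.integrableOn_unitSquare
      have h := integral_congr_ae (μ := volume.restrict unitSquare)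
        (Filter.Eventually.of_forall (hpde s hs))
      rw [integral_const_mul, integral_add iY'' i₁₂, integral_add i₁ i₂, z₁, z₂,
        integral_sub (iY'.const_mul _) (iY.const_mul _), integral_const_mul,
        integral_const_mul, add_zero, add_zero] at h
      exact h
    · have hup : Filter.Tendsto (fun s : ℝ => exp M * s ^ 3) (nhdsWithin 0 (Set.Ioi 0))
          (nhds 0) := by
        have : Continuous fun s : ℝ => exp M * s ^ 3 := by fun_prop
        simpa using (this.tendsto 0).mono_left (nhdsWithin_le_nhds (s := Set.Ioi 0))
      refine tendsto_of_tendsto_of_tendsto_of_le_of_le' tendsto_const_nhds hup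
        (Filter.Eventually.of_forall fun s => integral_nonneg fun z => (exp_pos _).le) ?_
      filter_upwards [Ioo_mem_nhdsGT hc] with s hs
      have h := integral_mono_unitSquare (f := fun z => exp (V s z)) (g := fun _ => exp M * s ^ 3)
        (hV s hs).continuous.rexp continuous_const fun z _ => ?_
      · simpa using h
      · rw [show exp M * s ^ 3 = exp (M + 3 * log s) by
          rw [exp_add, show (3:ℝ) * log s = ((3:ℕ):ℝ) * log s by norm_num, exp_nat_mul,
            exp_log hs.1]]
        exact exp_le_exp.2 (by linarith [(abs_le.1 (hM s hs z)).2])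
  set h : ℝ → ℝ := fun s => α * (s ^ 3 * (2 * c - s) / c ^ 4) with hh
  set h' : ℝ → ℝ := fun s => α * ((6 * c * s ^ 2 - 4 * s ^ 3) / c ^ 4) with hh'
  set h'' : ℝ → ℝ := fun s => α * ((12 * c * s - 12 * s ^ 2) / c ^ 4) with hh''
  have h_pos : ∀ s ∈ Set.Ioo 0 c, 0 < h s := by
    intro s hs
    have h1 := hs.1
    have h2 : 0 < 2 * c - s := by linarith [hs.2]
    positivity
  have dh : ∀ s, HasDerivAt h (h' s) s := fun s =>
    (((((hasDerivAt_id' s).fun_pow 3).fun_mul ((hasDerivAt_id' s).const_sub (2 * c))).div_const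
      (c ^ 4)).const_mul α).congr_deriv (by simp only [hh']; push_cast; ring)
  have dh' : ∀ s, HasDerivAt h' (h'' s) s := fun s =>
    ((((((hasDerivAt_id' s).fun_pow 2).const_mul (6 * c)).fun_sub
      (((hasDerivAt_id' s).fun_pow 3).const_mul 4)).div_const
      (c ^ 4)).const_mul α).congr_deriv (by simp only [hh'']; push_cast; ring)
  set D : ℝ → ℝ := fun s => s ^ 2 - 3 * c * s + 3 * c ^ 2 with hD
  have hDl : ∀ s ∈ Set.Ioo 0 c, c ^ 2 ≤ D s := fun s hs => by
    simp only [hD]; nlinarith [hs.1, hs.2]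
  have hDu : ∀ s ∈ Set.Ioo 0 c, D s ≤ 3 * c ^ 2 := fun s hs => by
    simp only [hD]; nlinarith [hs.1, hs.2]
  have hDp : ∀ s ∈ Set.Ioo 0 c, 0 < D s := fun s hs => lt_of_lt_of_le (by positivity) (hDl s hs)
  have dD : ∀ s, HasDerivAt D (2 * s - 3 * c) s := fun s =>
    ((((hasDerivAt_id' s).fun_pow 2).fun_sub ((hasDerivAt_id' s).const_mul (3 * c))).add_const
      (3 * c ^ 2)).congr_deriv (by push_cast; ring)
  have hN : ∀ s, 12 + (s - c) ^ 3 = s * D s := fun s => by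
    simp only [hD]; linear_combination -hc3
  set ρ : ℝ → ℝ := fun s => (2 * c - s) / D s with hρ
  set ρ' : ℝ → ℝ := fun s => (-D s - (2 * c - s) * (2 * s - 3 * c)) / D s ^ 2 with hρ'
  have dρ : ∀ s ∈ Set.Ioo 0 c, HasDerivAt ρ (ρ' s) s := fun s hs =>
    (((hasDerivAt_id' s).const_sub (2 * c)).fun_div (dD s) (hDp s hs).ne').congr_deriv
      (by simp only [hρ']; ring)
  have hρ0 : ∀ s ∈ Set.Ioo 0 c, 0 < ρ s := fun s hs =>
    div_pos (by linarith [hs.1, hs.2]) (hDp s hs)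
  have hρb : ∀ s ∈ Set.Ioo 0 c, ρ s ≤ 2 / c := by
    intro s hs
    simp only [hρ]
    rw [div_le_div_iff₀ (hDp s hs) hc]
    nlinarith [hDl s hs, hs.1, hs.2]
  have hρ'b : ∀ s ∈ Set.Ioo 0 c, |ρ' s| ≤ 9 / c ^ 2 := by
    intro s hs
    have h1 := hs.1
    have h2 := hs.2
    simp only [hρ']
    rw [abs_div, abs_of_pos (pow_pos (hDp s hs) 2), div_le_div_iff₀ (pow_pos (hDp s hs) 2)
      (by positivity)]
    have hnum : |-D s - (2 * c - s) * (2 * s - 3 * c)| ≤ 9 * c ^ 2 := by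
      rw [abs_le]
      constructor <;> simp only [hD] <;> nlinarith
    have hD2 : (c ^ 2) ^ 2 ≤ D s ^ 2 := pow_le_pow_left₀ (by positivity) (hDl s hs) 2
    calc _ ≤ 9 * c ^ 2 * c ^ 2 := by gcongr
      _ ≤ 9 * D s ^ 2 := by linarith
  set β := (α / c ^ 4) ^ 2 with hβ
  have hβ0 : 0 < β := by positivity
  set M' := M + |log (α / c ^ 4)| + |log c| + |log (2 * c)| with hM'
  have hu : ∀ s ∈ Set.Ioo 0 c, ∀ z, |V s z - log (h s)| ≤ M' := by
    intro s hs z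
    have h1 := hs.1
    have h2 : 0 < 2 * c - s := by linarith [hs.2]
    have e : log (h s) = log (α / c ^ 4) + 3 * log s + log (2 * c - s) := by
      rw [show h s = α / c ^ 4 * s ^ 3 * (2 * c - s) by simp only [hh]; ring,
        log_mul (by positivity) h2.ne', log_mul (by positivity) (by positivity), log_pow]
      norm_num
    have l1 : log c ≤ log (2 * c - s) := log_le_log hc (by linarith [hs.2])
    have l2 : log (2 * c - s) ≤ log (2 * c) := log_le_log h2 (by linarith)
    have b := abs_le.1 (hM s hs z)
    rw [e, abs_le, hM']
    constructor
    · linarith [le_abs_self (log (α / c ^ 4)), le_abs_self (log (2 * c)), abs_nonneg (log c)]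
    · linarith [neg_abs_le (log (α / c ^ 4)), neg_abs_le (log c), abs_nonneg (log (2 * c))]
  have hexp : ∀ s ∈ Set.Ioo 0 c, ∀ z, exp (V s z - log (h s)) = exp (V s z) / h s :=
    fun s hs z => by rw [exp_sub, exp_log (h_pos s hs)]
  have hlogc : ContinuousOn (fun p : ℝ × ℝ × ℝ => log (h p.1)) (Set.Ioo 0 c ×ˢ Set.univ) := by
    refine ContinuousOn.log ?_ fun p hp => (h_pos p.1 hp.1).ne'
    exact ((show Continuous h by fun_prop).comp continuous_fst).continuousOn
  have hhc : ∀ {f : ℝ → ℝ}, Continuous f →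
      ContinuousOn (fun p : ℝ × ℝ × ℝ => f p.1) (Set.Ioo 0 c ×ˢ Set.univ) :=
    fun hf => (hf.comp continuous_fst).continuousOn
  have ch := hhc (show Continuous h by fun_prop)
  have ch' := hhc (show Continuous h' by fun_prop)
  have ch'' := hhc (show Continuous h'' by fun_prop)
  have hne : ∀ n : ℕ, ∀ p ∈ Set.Ioo 0 c ×ˢ (Set.univ : Set (ℝ × ℝ)), h p.1 ^ n ≠ 0 :=
    fun n p hp => pow_ne_zero n (h_pos p.1 hp.1).ne'
  suffices hdec : ∃ C > (0:ℝ), ∃ δ > (0:ℝ), ∀ s, 0 < s → s ≤ c / 4 → ∀ z ∈ unitSquare,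
      |V s z - log (h s)| ≤ C * exp (-δ * (√s)⁻¹) by
    obtain ⟨C, hC, δ, hδ, hdec⟩ := hdec
    have hM'0 : 0 ≤ M' := (abs_nonneg _).trans (hu (c / 2) ⟨by linarith, by linarith⟩ 0)
    refine ⟨C + M' * exp (δ * (√(c / 4))⁻¹), by positivity, δ, hδ, fun s hs z => ?_⟩
    rcases le_total s (c / 4) with hs4 | hs4
    · have hz := hdec s hs.1 hs4 (Int.fract z.1, Int.fract z.2)
        ⟨⟨Int.fract_nonneg _, (Int.fract_lt_one _).le⟩,
          ⟨Int.fract_nonneg _, (Int.fract_lt_one _).le⟩⟩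
      rw [(hper s hs).apply_fract z] at hz
      refine hz.trans ?_
      gcongr
      exact le_add_of_nonneg_right (by positivity)
    · refine (hu s hs z).trans ?_
      rw [add_mul, mul_assoc, ← exp_add]
      refine le_add_of_nonneg_of_le (by positivity) (le_mul_of_one_le_right hM'0 (one_le_exp ?_))
      have : (√s)⁻¹ ≤ (√(c / 4))⁻¹ :=
        inv_anti₀ (Real.sqrt_pos.2 (by positivity)) (Real.sqrt_le_sqrt hs4)
      nlinarith
  refine cusp_decay (L := c) (k := β * (52 / c ^ 2))
    (q := α / (9 * c ^ 7)) (M := M')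
    (u := fun s z => V s z - log (h s))
    (ws := fun s z => (Y' s z * h s - exp (V s z) * h' s) / h s ^ 2)
    (wss := fun s z => (Y'' s z * h s - exp (V s z) * h'' s) / h s ^ 2 -
      2 * h' s * (Y' s z * h s - exp (V s z) * h' s) / h s ^ 3)
    (P := fun s => β * (s ^ 4 * ρ s ^ 2))
    (P' := fun s => β * (4 * s ^ 3 * ρ s ^ 2 + s ^ 4 * (2 * ρ s * ρ' s)))
    (Q := fun s => h s / (s * D s) ^ 2) hc (by positivity) (by positivity)
    ?_ ?_ ?_ he₁ he₂ ?_ ?_ hu ?_ ?_ ?_ ?_ ?_ ?_ ?_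
  · intro s hs
    have h1 := hs.1
    have h2 := hρ0 s hs
    refine ⟨by positivity, ?_⟩
    calc β * (s ^ 4 * ρ s ^ 2) ≤ β * (s ^ 4 * (2 / c) ^ 2) := by
          gcongr
          exact hρb s hs
      _ = β * (4 / c ^ 2) * s ^ 4 := by ring
      _ ≤ β * (52 / c ^ 2) * s ^ 4 := by gcongr; norm_num
  · intro s hs
    have h1 := hs.1
    have h2 := hρ0 s hs
    constructor
    · exact ((((hasDerivAt_id' s).fun_pow 4).fun_mul ((dρ s hs).fun_pow 2)).const_mul
        β).congr_deriv (by push_cast; ring)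
    · rw [abs_mul, abs_of_pos hβ0]
      calc β * |4 * s ^ 3 * ρ s ^ 2 + s ^ 4 * (2 * ρ s * ρ' s)|
          ≤ β * (4 * s ^ 3 * ρ s ^ 2 + s ^ 4 * (2 * ρ s * |ρ' s|)) := by
            refine mul_le_mul_of_nonneg_left ((abs_add_le _ _).trans (le_of_eq ?_)) hβ0.le
            rw [abs_of_pos (show 0 < 4 * s ^ 3 * ρ s ^ 2 by positivity), abs_mul, abs_mul,
              abs_of_pos (show 0 < s ^ 4 by positivity), abs_of_pos (show 0 < 2 * ρ s by positivity)]
        _ = β * (4 * s ^ 3 * ρ s ^ 2 + s ^ 3 * s * (2 * ρ s * |ρ' s|)) := by ring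
        _ ≤ β * (4 * s ^ 3 * (2 / c) ^ 2 + s ^ 3 * c * (2 * (2 / c) * (9 / c ^ 2))) := by
            gcongr
            · exact hρb s hs
            · exact hs.2.le
            · exact hρb s hs
            · exact hρ'b s hs
        _ = β * (52 / c ^ 2) * s ^ 3 := by
            field_simp
            ring
  · intro s hs
    have h1 := hs.1
    have h2 := hDp s hs
    rw [le_div_iff₀ (by positivity)]
    calc α / (9 * c ^ 7) * s * (s * D s) ^ 2 ≤ α / (9 * c ^ 7) * s * (s * (3 * c ^ 2)) ^ 2 := by
          gcongr
          exact hDu s hs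
      _ = α * (s ^ 3 * c / c ^ 4) := by field_simp; norm_num
      _ ≤ h s := by
          simp only [hh]
          gcongr
          linarith [hs.2]
  · intro s hs
    exact (hV s hs).sub contDiff_const
  · intro s hs z
    have := hper s hs z
    exact ⟨by simp only [this.1], by simp only [this.2]⟩
  · intro s hs z
    refine (((hY s hs z).fun_div (dh s) (h_pos s hs).ne')).congr_of_eventuallyEq ?_
    filter_upwards [isOpen_Ioo.mem_nhds hs] with t ht using hexp t ht z
  · intro s hs z
    have hp := (h_pos s hs).ne'
    refine ((((hY' s hs z).fun_mul (dh s)).fun_sub ((hY s hs z).fun_mul (dh' s))).fun_div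
      ((dh s).fun_pow 2) (pow_ne_zero _ hp)).congr_deriv ?_
    push_cast
    field_simp
    ring
  · exact cV.sub hlogc
  · exact ((cY'.mul ch).sub (cV.rexp.mul ch')).div (ch.pow 2) (hne 2)
  · exact (((cY''.mul ch).sub (cV.rexp.mul ch'')).div (ch.pow 2) (hne 2)).sub
      (((continuousOn_const.mul ch').mul ((cY'.mul ch).sub (cV.rexp.mul ch'))).div (ch.pow 3)
        (hne 3))
  · intro s hs
    simp only [hexp s hs]
    rw [integral_div, hmean s hs, div_self (h_pos s hs).ne']
  · intro s hs z
    have hd : ∀ z e, fderiv ℝ (fun z => V s z - log (h s)) z e = fderiv ℝ (V s) z e :=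
      fun z e => by rw [fderiv_sub_const]
    simp only [hd]
    have hp := hpde s hs z
    rw [hN] at hp
    have hDne := (hDp s hs).ne'
    have hsne := hs.1.ne'
    have hhne := (h_pos s hs).ne'
    have hode : s * D s * h'' s = 6 * (s - c) ^ 2 * h' s - 12 * (s - c) * h s := by
      simp only [hD, hh, hh', hh'']
      ring
    have hN' : D s + s * (2 * s - 3 * c) = 3 * (s - c) ^ 2 := by
      simp only [hD]
      ring
    have eP : β * (s ^ 4 * ρ s ^ 2) = h s ^ 2 / (s * D s) ^ 2 := by
      simp only [hβ, hρ, hh]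
      field_simp
    have eP' : β * (4 * s ^ 3 * ρ s ^ 2 + s ^ 4 * (2 * ρ s * ρ' s)) =
        2 * h s * h' s / (s * D s) ^ 2 - 2 * h s ^ 2 * (3 * (s - c) ^ 2) / (s * D s) ^ 3 := by
      rw [← hN']
      simp only [hβ, hρ, hρ', hh, hh']
      field_simp
      ring
    rw [eP, eP']
    generalize fderiv ℝ (fun z => fderiv ℝ (V s) z e₁) z e₁ +
      fderiv ℝ (fun z => fderiv ℝ (V s) z e₂) z e₂ = Δ at hp ⊢
    generalize h'' s = h2 at hode ⊢
    generalize h' s = h1 at hode ⊢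
    generalize h s = h0 at hode hhne ⊢
    generalize D s = d at hp hode hDne ⊢
    field_simp
    linear_combination h0 ^ 2 * hp - h0 * exp (V s z) * hode

lemma hasDerivAt_fderiv_time {G : ℝ × ℝ × ℝ → ℝ} {U : Set (ℝ × ℝ × ℝ)} (hU : IsOpen U)
    (hG : ContDiffOn ℝ 1 G U) {s : ℝ} {w : ℝ × ℝ} (h : (s, w) ∈ U) :
    HasDerivAt (fun s => G (s, w)) (fderiv ℝ G (s, w) (1, 0)) s := by
  have hd := ((hG.differentiableOn (by norm_num)).differentiableAt (hU.mem_nhds h)).hasFDerivAt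
  exact hd.comp_hasDerivAt s ((hasDerivAt_id s).prodMk (hasDerivAt_const s w))

lemma fderiv_comp_clm_apply {f : ℝ × ℝ → ℝ} (hf : Differentiable ℝ f)
    (T : ℝ × ℝ →L[ℝ] ℝ × ℝ) (z e : ℝ × ℝ) :
    fderiv ℝ (fun z => f (T z)) z e = fderiv ℝ f (T z) (T e) := by
  have h := (hf (T z)).hasFDerivAt.comp z T.hasFDerivAt
  rw [show fderiv ℝ (fun z => f (T z)) z = _ from h.fderiv]
  rfl

lemma deriv_deriv_fst {f : ℝ × ℝ → ℝ} (hf : ContDiff ℝ 2 f) (x y : ℝ) :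
    deriv (deriv fun x' => f (x', y)) x =
      fderiv ℝ (fun p => fderiv ℝ f p (1, 0)) (x, y) (1, 0) := by
  have key : ∀ {g : ℝ × ℝ → ℝ}, ContDiff ℝ 1 g → ∀ x, HasDerivAt (fun x' => g (x', y))
      (fderiv ℝ g (x, y) (1, 0)) x := fun hg x =>
    ((hg.differentiable (by norm_num)) (x, y)).hasFDerivAt.comp_hasDerivAt x
      ((hasDerivAt_id x).prodMk (hasDerivAt_const x y))
  rw [funext fun x => (key (hf.of_le (by norm_num)) x).deriv]
  exact (key (hf.fderiv_apply_const (1, 0)) x).deriv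

lemma deriv_deriv_snd {f : ℝ × ℝ → ℝ} (hf : ContDiff ℝ 2 f) (x y : ℝ) :
    deriv (deriv fun y' => f (x, y')) y =
      fderiv ℝ (fun p => fderiv ℝ f p (0, 1)) (x, y) (0, 1) := by
  have key : ∀ {g : ℝ × ℝ → ℝ}, ContDiff ℝ 1 g → ∀ y, HasDerivAt (fun y' => g (x, y'))
      (fderiv ℝ g (x, y) (0, 1)) y := fun hg y =>
    ((hg.differentiable (by norm_num)) (x, y)).hasFDerivAt.comp_hasDerivAt y
      ((hasDerivAt_const y x).prodMk (hasDerivAt_id y))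
  rw [funext fun y => (key (hf.of_le (by norm_num)) y).deriv]
  exact (key (hf.fderiv_apply_const (0, 1)) y).deriv

lemma neg_xiStar_pos : 0 < -xiStar := by
  unfold xiStar
  rw [neg_neg]
  positivity

lemma neg_xiStar_pow_three : (-xiStar) ^ 3 = 12 := by
  unfold xiStar
  rw [neg_neg, ← Real.rpow_natCast, ← Real.rpow_mul (by norm_num)]
  norm_num

/-- Model asymptotics for BVP3: `v` converges to
`v_mod = φ̄ + 3log(1 − ξ/ξ*) + log(1 + ξ/ξ*)` at rate `exp(−δ(ξ−ξ*)^{−1/2})`. -/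
theorem stmt11
    (v1 v2 : ℝ × ℝ) (hdet : |v1.1 * v2.2 - v1.2 * v2.1| = 1)
    (φ : ℝ → ℝ → ℝ)
    (hφreg : ContDiff ℝ (⊤ : ℕ∞) (fun p : ℝ × ℝ => φ p.1 p.2))
    (hφper : LatticePeriodic v1 v2 φ)
    (v : ℝ → ℝ → ℝ → ℝ) (hv : IsSolBVP3 v1 v2 φ v) :
    ∃ C > (0:ℝ), ∃ δ > (0:ℝ), ∀ ξ : ℝ, xiStar < ξ → ξ < 0 → ∀ x y : ℝ,
      |v ξ x y -
          (Real.log (sliceAvg v1 v2 (fun x' y' => Real.exp (φ x' y'))) +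
            3 * Real.log (1 - ξ / xiStar) + Real.log (1 + ξ / xiStar))| ≤
        C * Real.exp (-δ / Real.sqrt (ξ - xiStar)) := by
  obtain ⟨hC2, hper, hbd, ⟨M, hM⟩, hpde⟩ := hv
  have hc := neg_xiStar_pos
  have hc3 := neg_xiStar_pow_three
  set c := -xiStar with hcdef
  have hxi : xiStar = -c := by rw [hcdef, neg_neg]
  -- the linear map from the unit square to the fundamental parallelogram
  set T : ℝ × ℝ →L[ℝ] ℝ × ℝ := (ContinuousLinearMap.fst ℝ ℝ ℝ).smulRight v1 +
    (ContinuousLinearMap.snd ℝ ℝ ℝ).smulRight v2 with hT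
  have T_apply : ∀ z, T z = (z.1 * v1.1 + z.2 * v2.1, z.1 * v1.2 + z.2 * v2.2) := fun z => rfl
  set J := v1.1 * v2.2 - v1.2 * v2.1 with hJ
  have hJ0 : J ≠ 0 := fun h => by simp [h] at hdet
  set e₁ : ℝ × ℝ := (v2.2 / J, -v1.2 / J) with he₁
  set e₂ : ℝ × ℝ := (-v2.1 / J, v1.1 / J) with he₂
  have Te₁ : T e₁ = (1, 0) := by
    rw [T_apply, he₁]
    ext <;> simp only <;> field_simp <;> rw [hJ] <;> ring
  have Te₂ : T e₂ = (0, 1) := by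
    rw [T_apply, he₂]
    ext <;> simp only <;> field_simp <;> rw [hJ] <;> ring
  have he₁' : (1, 0) = v1.1 • e₁ + v1.2 • e₂ := by
    ext <;> simp [he₁, he₂] <;> field_simp <;> rw [hJ] <;> ring
  have he₂' : (0, 1) = v2.1 • e₁ + v2.2 • e₂ := by
    ext <;> simp [he₁, he₂] <;> field_simp <;> rw [hJ] <;> ring
  set U : Set (ℝ × ℝ × ℝ) := {p | xiStar < p.1 ∧ p.1 < 0} with hU
  have hUo : IsOpen U :=
    (isOpen_lt continuous_const continuous_fst).inter (isOpen_lt continuous_fst continuous_const)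
  have hG : ContDiffOn ℝ 2 (fun p : ℝ × ℝ × ℝ => v p.1 p.2.1 p.2.2) U :=
    hC2.mono fun p hp => ⟨hp.1, hp.2.le⟩
  set E : ℝ × ℝ × ℝ → ℝ := fun p => exp (v p.1 p.2.1 p.2.2) with hE
  have hEc : ContDiffOn ℝ 2 E U := hG.exp
  set E' : ℝ × ℝ × ℝ → ℝ := fun p => fderiv ℝ E p (1, 0) with hE'
  have hE'c : ContDiffOn ℝ 1 E' U :=
    (hEc.fderiv_of_isOpen hUo (m := 1) (by norm_num)).clm_apply contDiffOn_const
  have hE''c : ContinuousOn (fun p => fderiv ℝ E' p (1, 0)) U :=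
    (hE'c.continuousOn_fderiv_of_isOpen hUo (by norm_num)).clm_apply continuousOn_const
  have hmem : ∀ s ∈ Set.Ioo 0 c, ∀ w : ℝ × ℝ, (s - c, w) ∈ U := fun s hs w =>
    ⟨by simp only [hxi]; linarith [hs.1], by simp only; linarith [hs.2]⟩
  have hsl : ∀ s ∈ Set.Ioo 0 c, ContDiff ℝ 2 fun p : ℝ × ℝ => v (s - c) p.1 p.2 := by
    intro s hs
    exact hG.comp_contDiff (f := fun p : ℝ × ℝ => (s - c, p)) (by fun_prop) fun p => hmem s hs p
  have hpull : ∀ {g : ℝ × ℝ × ℝ → ℝ}, ContinuousOn g U →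
      ContinuousOn (fun p : ℝ × ℝ × ℝ => g (p.1 - c, T p.2)) (Set.Ioo 0 c ×ˢ Set.univ) :=
    fun hg => hg.comp (f := fun p : ℝ × ℝ × ℝ => (p.1 - c, T p.2)) (by fun_prop)
      fun p hp => hmem p.1 hp.1 _
  have hdt : ∀ {g : ℝ × ℝ × ℝ → ℝ}, ContDiffOn ℝ 1 g U → ∀ s ∈ Set.Ioo 0 c, ∀ w,
      HasDerivAt (fun s => g (s - c, w)) (fderiv ℝ g (s - c, w) (1, 0)) s := fun hg s hs w =>
    (hasDerivAt_fderiv_time hUo hg (hmem s hs w)).comp_sub_const s c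
  have hbd' : ∀ s ∈ Set.Ioo 0 c, ∀ z, |v (s - c) (T z).1 (T z).2 - 3 * log s| ≤ M := by
    intro s hs z
    have h := hM (s - c) (hmem s hs z).1 (hmem s hs z).2 (T z).1 (T z).2
    rwa [show s - c - xiStar = s by rw [hxi]; ring] at h
  set α := sliceAvg v1 v2 (fun x' y' => exp (φ x' y')) with hαdef
  have hφT : Continuous fun z => φ (T z).1 (T z).2 :=
    hφreg.continuous.comp (f := fun z => T z) (by fun_prop)
  have hα : ∫ z in unitSquare, exp (φ (T z).1 (T z).2) = α :=
    integral_unitSquare hφT.rexp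
  have hα0 : 0 < α := by
    rw [← hα]
    exact integral_exp_pos hφT.rexp.integrableOn_unitSquare
  obtain ⟨C, hC, δ, hδ, h⟩ := twistedToda_decay (V := fun s z => v (s - c) (T z).1 (T z).2)
    (Y' := fun s z => E' (s - c, T z)) (Y'' := fun s z => fderiv ℝ E' (s - c, T z) (1, 0))
    (α := α) (M := M) hc hc3 hα0 he₁' he₂' (fun s hs => (hsl s hs).comp T.contDiff)
    (fun s hs z => by
      obtain ⟨h1, h2⟩ := hper (s - c) (hmem s hs z).1 (hmem s hs z).2.le (T z).1 (T z).2
      constructor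
      · refine Eq.trans ?_ h1
        simp only [T_apply, Prod.fst_add, Prod.snd_add]
        congr 1 <;> ring
      · refine Eq.trans ?_ h2
        simp only [T_apply, Prod.fst_add, Prod.snd_add]
        congr 1 <;> ring)
    hbd' (fun s hs z => hdt (hEc.of_le (by norm_num)) s hs (T z))
    (fun s hs z => hdt hE'c s hs (T z)) (hpull hG.continuousOn) (hpull hE'c.continuousOn)
    (hpull hE''c)
    (fun s hs z => by
      obtain ⟨h1, h2⟩ := hmem s hs (T z)
      have hp := hpde (s - c) h1 h2 (T z).1 (T z).2
      have hf := hsl s hs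
      unfold TwistedToda at hp
      have t1 : ∀ r, (r, T z) ∈ U → HasDerivAt (fun s => exp (v s (T z).1 (T z).2))
          (E' (r, T z)) r := fun r hr =>
        hasDerivAt_fderiv_time (w := T z) hUo (hEc.of_le (by norm_num)) hr
      have t2 : deriv (deriv fun s => exp (v s (T z).1 (T z).2)) (s - c) =
          fderiv ℝ E' (s - c, T z) (1, 0) := by
        have : deriv (fun s => exp (v s (T z).1 (T z).2)) =ᶠ[nhds (s - c)]
            fun r => E' (r, T z) := by
          filter_upwards [Ioo_mem_nhds h1 h2] with r hr using (t1 r hr).deriv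
        rw [this.deriv_eq]
        exact (hasDerivAt_fderiv_time hUo hE'c (hmem s hs (T z))).deriv
      have t3 : E' (s - c, T z) = exp (v (s - c) (T z).1 (T z).2) *
          deriv (fun s => v s (T z).1 (T z).2) (s - c) := by
        have hd := hasDerivAt_fderiv_time hUo (hG.of_le (by norm_num)) (hmem s hs (T z))
        rw [← (t1 (s - c) (hmem s hs (T z))).deriv]
        exact hd.differentiableAt.hasDerivAt.exp.deriv
      have lap : ∀ e, fderiv ℝ (fun z => fderiv ℝ (fun z => v (s - c) (T z).1 (T z).2) z e) z e =
          fderiv ℝ (fun p => fderiv ℝ (fun p : ℝ × ℝ => v (s - c) p.1 p.2) p (T e)) (T z) (T e) := by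
        intro e
        simp only [fderiv_comp_clm_apply (hf.differentiable (by norm_num)) T]
        exact fderiv_comp_clm_apply ((hf.fderiv_apply_const (T e)).differentiable (by norm_num)) T z e
      rw [t2, deriv_deriv_fst hf, deriv_deriv_snd hf] at hp
      simp only [lap, Te₁, Te₂]
      have hN : 12 + (s - c) ^ 3 ≠ 0 := by
        rw [← hc3]
        have := hs.1
        have : 0 < s * ((c - s) * (2 * c - s) + c ^ 2) := by
          have := sub_pos.2 hs.2
          have : 0 < 2 * c - s := by linarith
          positivity
        refine ne_of_gt ?_
        linarith
      rw [← add_assoc, hp, t3]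
      field_simp
      ring)
    (by
      rw [← hα]
      refine tendsto_integral_filter_of_dominated_convergence (fun _ => exp (M + 3 * log c))
        ?_ ?_ (integrable_const _) ?_
      · filter_upwards [Ioo_mem_nhdsLT hc] with s hs
        exact (((hsl s hs).comp T.contDiff).continuous.rexp).aestronglyMeasurable
      · filter_upwards [Ioo_mem_nhdsLT hc] with s hs
        refine Filter.Eventually.of_forall fun z => ?_
        rw [Real.norm_of_nonneg (exp_pos _).le]
        have h1 := (abs_le.1 (hbd' s hs z)).2
        have h2 := log_le_log hs.1 hs.2.le
        exact exp_le_exp.2 (by linarith)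
      · refine Filter.Eventually.of_forall fun z => ?_
        refine (Real.continuous_exp.tendsto _).comp ?_
        rw [← hbd]
        have hcw := hC2.continuousOn (0, T z) ⟨by simp only [hxi]; linarith, le_rfl⟩
        refine hcw.tendsto.comp (f := fun s => (s - c, T z)) ?_
        refine tendsto_nhdsWithin_iff.2 ⟨?_, ?_⟩
        · have : Continuous fun s : ℝ => (s - c, T z) := by fun_prop
          simpa using (this.tendsto c).mono_left (nhdsWithin_le_nhds (s := Set.Iio c))
        · filter_upwards [Ioo_mem_nhdsLT hc] with s hs
          exact ⟨(hmem s hs (T z)).1, (hmem s hs (T z)).2.le⟩)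
  refine ⟨C, hC, δ, hδ, fun ξ hξ1 hξ2 x y => ?_⟩
  have hs : ξ + c ∈ Set.Ioo 0 c := ⟨by rw [hxi] at hξ1; linarith, by linarith⟩
  have hTz : T (x • e₁ + y • e₂) = (x, y) := by
    rw [map_add, map_smul, map_smul, Te₁, Te₂]
    simp
  have hb := h (ξ + c) hs (x • e₁ + y • e₂)
  simp only [hTz, add_sub_cancel_right] at hb
  have hs1 := hs.1
  have hs2 : 0 < 2 * c - (ξ + c) := by linarith
  have hlog : log α + 3 * log (1 - ξ / xiStar) + log (1 + ξ / xiStar) =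
      log (α * ((ξ + c) ^ 3 * (2 * c - (ξ + c)) / c ^ 4)) := by
    have q1 : 1 - ξ / xiStar = (ξ + c) / c := by rw [hxi]; field_simp; ring
    have q2 : 1 + ξ / xiStar = (2 * c - (ξ + c)) / c := by rw [hxi]; field_simp; ring
    rw [q1, q2, show α * ((ξ + c) ^ 3 * (2 * c - (ξ + c)) / c ^ 4) =
      α * ((ξ + c) / c) ^ 3 * ((2 * c - (ξ + c)) / c) by field_simp,
      log_mul (by positivity) (by positivity), log_mul (by positivity) (by positivity), log_pow]
    norm_num
  rw [hlog, show ξ - xiStar = ξ + c by rw [hxi]; ring, div_eq_mul_inv]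
  exact hb
end
end

section
/- Set ξ* := −12^{1/3}. Let Λ ⊂ ℝ² be a lattice of covolume 1, let φ : ℝ² → ℝ be a smooth Λ-periodic function, and let v : (ξ*, 0] × ℝ² → ℝ be a twice continuously differentiable, Λ-periodic solution of the twisted Toda equation (e^v)_{ξξ} + v_{xx} + v_{yy} = −ξ·((12 − 6ξ v_ξ)/(12 + ξ³))·e^v with v(0,·) = φ such that v − 3·log(ξ − ξ*) is bounded. Then W := (12 − 6ξ·v_ξ(ξ,x,y))/(12 + ξ³) > 0 for all ξ ∈ (ξ*, 0] and all (x,y) ∈ ℝ². -/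
open Real MeasureTheory

noncomputable section

/-- Second derivative test, necessary direction. -/
theorem IsLocalMax.deriv_deriv_nonpos {f : ℝ → ℝ} {x : ℝ} (h : IsLocalMax f x)
    (hf : ContinuousAt f x) : deriv (deriv f) x ≤ 0 := by
  by_contra! hpos
  have hmin : IsLocalMin f x := isLocalMin_of_deriv_deriv_pos hpos h.deriv_eq_zero hf
  have heq : f =ᶠ[nhds x] fun _ => f x := by
    filter_upwards [h, hmin] with y h1 h2
    exact le_antisymm h1 h2
  have := heq.deriv.deriv_eq
  simp at this
  linarith

theorem ContDiffAt.differentiableAt_deriv {f : ℝ → ℝ} {x : ℝ} (hf : ContDiffAt ℝ 2 f x) :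
    DifferentiableAt ℝ (deriv f) x := by
  have h : ContDiffAt ℝ 1 (fderiv ℝ f) x := hf.fderiv_right (by norm_num)
  exact (h.differentiableAt (by simp)).clm_apply (differentiableAt_const (1 : ℝ))

theorem deriv_deriv_sub {f g : ℝ → ℝ} {x : ℝ} (hf : ContDiffAt ℝ 2 f x)
    (hg : ContDiffAt ℝ 2 g x) :
    deriv (deriv (fun s => f s - g s)) x = deriv (deriv f) x - deriv (deriv g) x := by
  have h : deriv (fun s => f s - g s) =ᶠ[nhds x] fun s => deriv f s - deriv g s := by
    filter_upwards [hf.eventually (by simp), hg.eventually (by simp)] with s h1 h2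
    exact deriv_fun_sub (h1.differentiableAt (by simp)) (h2.differentiableAt (by simp))
  rw [h.deriv_eq]
  exact deriv_fun_sub hf.differentiableAt_deriv hg.differentiableAt_deriv

/-- First and second order conditions at a point where `f` touches `g` from below. -/
theorem touching_below {f g : ℝ → ℝ} {x : ℝ} (hf : ContDiffAt ℝ 2 f x)
    (hg : ContDiffAt ℝ 2 g x) (h : IsLocalMax (fun s => f s - g s) x) :
    deriv f x = deriv g x ∧ deriv (deriv f) x ≤ deriv (deriv g) x := by
  have h1 := h.deriv_eq_zero
  have h2 := h.deriv_deriv_nonpos (hf.continuousAt.sub hg.continuousAt)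
  rw [deriv_fun_sub (hf.differentiableAt (by simp)) (hg.differentiableAt (by simp))] at h1
  rw [deriv_deriv_sub hf hg] at h2
  exact ⟨by linarith, by linarith⟩

theorem xiStar_neg : xiStar < 0 := by
  unfold xiStar
  have := Real.rpow_pos_of_pos (show (0:ℝ) < 12 by norm_num) ((1:ℝ)/3)
  linarith

theorem xiStar_cube : xiStar ^ 3 = -12 := by
  unfold xiStar
  have : ((12 : ℝ) ^ ((1:ℝ)/3)) ^ 3 = 12 := by
    rw [← Real.rpow_natCast, ← Real.rpow_mul (by norm_num)]
    norm_num
  linear_combination -this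

theorem twelve_add_cube_pos {ξ : ℝ} (h : xiStar < ξ) : 0 < 12 + ξ ^ 3 := by
  have h1 : xiStar ^ 3 < ξ ^ 3 := Odd.strictMono_pow (by decide) h
  rw [xiStar_cube] at h1
  linarith

theorem twelve_add_cube_le {ξ : ℝ} (h : xiStar < ξ) (h0 : ξ < 0) :
    12 + ξ ^ 3 ≤ 3 * xiStar ^ 2 * (ξ - xiStar) := by
  have h1 : 12 + ξ ^ 3 = (ξ ^ 2 + ξ * xiStar + xiStar ^ 2) * (ξ - xiStar) := by
    linear_combination xiStar_cube
  rw [h1]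
  have : 0 < ξ - xiStar := by linarith
  gcongr
  nlinarith

/-- The quartic `−ξ(12 + ξ³ + ε)`; with `ε = 0` it is the comparison function, and the
`ε`-term is the penalization at `ξ*`. -/
def barrier (ε ξ : ℝ) : ℝ := -ξ * (12 + ξ ^ 3 + ε)

theorem barrier_pos {ε ξ : ℝ} (hε : 0 ≤ ε) (h : xiStar < ξ) (h0 : ξ < 0) :
    0 < barrier ε ξ := by
  have := twelve_add_cube_pos h
  exact mul_pos (by linarith) (by linarith)

theorem deriv_barrier (ε : ℝ) : deriv (barrier ε) = fun ξ => -(12 + 4 * ξ ^ 3 + ε) := by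
  funext ξ
  have h := ((hasDerivAt_id ξ).neg).mul ((((hasDerivAt_id ξ).pow 3).const_add 12).add_const ε)
  have h2 : HasDerivAt (barrier ε) (-(12 + 4 * ξ ^ 3 + ε)) ξ := by
    refine HasDerivAt.congr_deriv (h.congr_of_eventuallyEq (.of_forall fun s => ?_)) ?_
    · simp [barrier]
    · simp; ring
  exact h2.deriv

theorem deriv_deriv_barrier (ε ξ : ℝ) : deriv (deriv (barrier ε)) ξ = -(12 * ξ ^ 2) := by
  rw [deriv_barrier]
  have h := ((((hasDerivAt_id ξ).pow 3).const_mul 4).const_add 12 |>.add_const ε).neg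
  have h2 : HasDerivAt (fun s : ℝ => -(12 + 4 * s ^ 3 + ε)) (-(12 * ξ ^ 2)) ξ := by
    refine HasDerivAt.congr_deriv (h.congr_of_eventuallyEq (.of_forall fun s => ?_)) ?_
    · simp
    · simp; ring
  exact h2.deriv

theorem contDiff_barrier (ε : ℝ) : ContDiff ℝ 2 (barrier ε) := by
  unfold barrier
  fun_prop

theorem LatticePeriodic.add_int {v1 v2 : ℝ × ℝ} {f : ℝ → ℝ → ℝ} (h : LatticePeriodic v1 v2 f)
    (m n : ℤ) (x y : ℝ) :
    f (x + m * v1.1 + n * v2.1) (y + m * v1.2 + n * v2.2) = f x y := by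
  have h1 : Function.Periodic (fun p : ℝ × ℝ => f p.1 p.2) v1 := fun p => (h p.1 p.2).1
  have h2 : Function.Periodic (fun p : ℝ × ℝ => f p.1 p.2) v2 := fun p => (h p.1 p.2).2
  have e1 := h1.int_mul m
  have e2 := h2.int_mul n
  have := (e2 ((x, y) + m * v1)).trans (e1 (x, y))
  simpa using this

/-- The closed fundamental parallelogram. -/
def fundamentalCell (v1 v2 : ℝ × ℝ) : Set (ℝ × ℝ) :=
  (fun q : ℝ × ℝ => (q.1 * v1.1 + q.2 * v2.1, q.1 * v1.2 + q.2 * v2.2)) ''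
    (Set.Icc 0 1 ×ˢ Set.Icc 0 1)

theorem isCompact_fundamentalCell (v1 v2 : ℝ × ℝ) : IsCompact (fundamentalCell v1 v2) :=
  (isCompact_Icc.prod isCompact_Icc).image (by fun_prop)

theorem exists_mem_fundamentalCell {v1 v2 : ℝ × ℝ} (hdet : |v1.1 * v2.2 - v1.2 * v2.1| = 1)
    (x y : ℝ) : ∃ q ∈ fundamentalCell v1 v2, ∀ f, LatticePeriodic v1 v2 f → f x y = f q.1 q.2 := by
  set d := v1.1 * v2.2 - v1.2 * v2.1 with hd
  have hd0 : d ≠ 0 := by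
    intro h
    simp [h] at hdet
  set s := (x * v2.2 - y * v2.1) / d with hs
  set t := (v1.1 * y - v1.2 * x) / d with ht
  have hx : x = s * v1.1 + t * v2.1 := by
    rw [hs, ht]; field_simp; rw [hd]; ring
  have hy : y = s * v1.2 + t * v2.2 := by
    rw [hs, ht]; field_simp; rw [hd]; ring
  refine ⟨_, ⟨(Int.fract s, Int.fract t), ⟨⟨Int.fract_nonneg _, (Int.fract_lt_one _).le⟩,
    ⟨Int.fract_nonneg _, (Int.fract_lt_one _).le⟩⟩, rfl⟩, fun f hf => ?_⟩
  refine Eq.trans ?_ (hf.add_int ⌊s⌋ ⌊t⌋ _ _)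
  have e1 := Int.fract_add_floor s
  have e2 := Int.fract_add_floor t
  congr 1
  · linear_combination hx - v1.1 * e1 - v2.1 * e2
  · linear_combination hy - v1.2 * e1 - v2.2 * e2

section Slices

variable {v : ℝ → ℝ → ℝ → ℝ}

theorem contDiffAt_of_contDiffOn
    (hC : ContDiffOn ℝ 2 (fun p : ℝ × ℝ × ℝ => v p.1 p.2.1 p.2.2)
      {p : ℝ × ℝ × ℝ | xiStar < p.1 ∧ p.1 ≤ 0}) {ξ : ℝ} (h : xiStar < ξ) (h0 : ξ < 0) (x y : ℝ) :
    ContDiffAt ℝ 2 (fun p : ℝ × ℝ × ℝ => v p.1 p.2.1 p.2.2) (ξ, x, y) := by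
  refine hC.contDiffAt ?_
  have : IsOpen {p : ℝ × ℝ × ℝ | xiStar < p.1 ∧ p.1 < 0} :=
    (isOpen_lt continuous_const continuous_fst).inter (isOpen_lt continuous_fst continuous_const)
  exact Filter.mem_of_superset (this.mem_nhds ⟨h, h0⟩) fun p hp => ⟨hp.1, hp.2.le⟩

theorem contDiffAt_slice_fst {ξ x y : ℝ}
    (hC : ContDiffAt ℝ 2 (fun p : ℝ × ℝ × ℝ => v p.1 p.2.1 p.2.2) (ξ, x, y)) :
    ContDiffAt ℝ 2 (fun s => v s x y) ξ :=
  hC.comp ξ (f := fun s : ℝ => (s, x, y)) (by fun_prop)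

theorem contDiffAt_slice_snd {ξ x y : ℝ}
    (hC : ContDiffAt ℝ 2 (fun p : ℝ × ℝ × ℝ => v p.1 p.2.1 p.2.2) (ξ, x, y)) :
    ContDiffAt ℝ 2 (fun s => v ξ s y) x :=
  hC.comp x (f := fun s : ℝ => (ξ, s, y)) (by fun_prop)

theorem contDiffAt_slice_trd {ξ x y : ℝ}
    (hC : ContDiffAt ℝ 2 (fun p : ℝ × ℝ × ℝ => v p.1 p.2.1 p.2.2) (ξ, x, y)) :
    ContDiffAt ℝ 2 (fun s => v ξ x s) y :=
  hC.comp y (f := fun s : ℝ => (ξ, x, s)) (by fun_prop)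

/-- The twisted Toda equation rewritten for `u = e^v`. -/
theorem TwistedToda.exp_form {ξ x y : ℝ} (h : TwistedToda v ξ x y)
    (hd : DifferentiableAt ℝ (fun s => v s x y) ξ) :
    deriv (deriv (fun s => Real.exp (v s x y))) ξ +
      deriv (deriv (fun x' => v ξ x' y)) x + deriv (deriv (fun y' => v ξ x y')) y =
    -ξ * (12 * Real.exp (v ξ x y) - 6 * ξ * deriv (fun s => Real.exp (v s x y)) ξ)
      / (12 + ξ ^ 3) := by
  rw [h, hd.hasDerivAt.exp.deriv]
  ring

/-- No interior maximum of `u(a) P(b) / (u(b) Q(a))` with value larger than one. -/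
theorem no_interior_touching
    (hC : ContDiffOn ℝ 2 (fun p : ℝ × ℝ × ℝ => v p.1 p.2.1 p.2.2)
      {p : ℝ × ℝ × ℝ | xiStar < p.1 ∧ p.1 ≤ 0})
    (hT : ∀ ξ : ℝ, xiStar < ξ → ξ < 0 → ∀ x y : ℝ, TwistedToda v ξ x y)
    {ε k l a b x y : ℝ} (hε : 0 ≤ ε) (hl : 0 < l) (hlk : l < k)
    (ha : xiStar < a) (hab : a ≤ b) (hb : b < 0)
    (hka : Real.exp (v a x y) = k * barrier ε a) (hlb : Real.exp (v b x y) = l * barrier 0 b)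
    (hmaxa : IsLocalMax (fun s => Real.exp (v s x y) - k * barrier ε s) a)
    (hminb : IsLocalMax (fun s => l * barrier 0 s - Real.exp (v s x y)) b)
    (hx : IsLocalMax (fun s => v a s y - v b s y) x)
    (hy : IsLocalMax (fun s => v a x s - v b x s) y) : False := by
  have hCa := contDiffAt_of_contDiffOn hC ha (by linarith) x y
  have hCb := contDiffAt_of_contDiffOn hC (ha.trans_le hab) hb x y
  have hbar : ∀ c δ t : ℝ, ContDiffAt ℝ 2 (fun s => c * barrier δ s) t := fun c δ t =>
    (contDiff_const.mul (contDiff_barrier δ)).contDiffAt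
  have hd1 : ∀ c δ t : ℝ, deriv (fun s => c * barrier δ s) t = -c * (12 + 4 * t ^ 3 + δ) := by
    intro c δ t
    rw [deriv_const_mul_field, deriv_barrier]; ring
  have hd2 : ∀ c δ t : ℝ, deriv (deriv (fun s => c * barrier δ s)) t = -c * (12 * t ^ 2) := by
    intro c δ t
    rw [deriv_const_mul_field', deriv_const_mul_field, deriv_deriv_barrier]; ring
  obtain ⟨p1, q1⟩ := touching_below (contDiffAt_slice_fst hCa).exp (hbar k ε a) hmaxa
  obtain ⟨p0, q0⟩ := touching_below (hbar l 0 b) (contDiffAt_slice_fst hCb).exp hminb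
  have X := (touching_below (contDiffAt_slice_snd hCa) (contDiffAt_slice_snd hCb) hx).2
  have Y := (touching_below (contDiffAt_slice_trd hCa) (contDiffAt_slice_trd hCb) hy).2
  have Ea := (hT a ha (by linarith) x y).exp_form
    ((contDiffAt_slice_fst hCa).differentiableAt (by simp))
  have Eb := (hT b (ha.trans_le hab) hb x y).exp_form
    ((contDiffAt_slice_fst hCb).differentiableAt (by simp))
  rw [hd1] at p1 p0
  rw [hd2] at q1 q0
  rw [p1, hka] at Ea
  rw [← p0, hlb] at Eb
  have Da := twelve_add_cube_pos ha
  have Db := twelve_add_cube_pos (ha.trans_le hab)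
  have ra : -a * (12 * (k * barrier ε a) - 6 * a * (-k * (12 + 4 * a ^ 3 + ε))) / (12 + a ^ 3)
      = -k * (12 * a ^ 2) + k * (216 + 6 * ε) * a ^ 2 / (12 + a ^ 3) := by
    unfold barrier; field_simp; ring
  have rb : -b * (12 * (l * barrier 0 b) - 6 * b * (-l * (12 + 4 * b ^ 3 + 0))) / (12 + b ^ 3)
      = -l * (12 * b ^ 2) + l * 216 * b ^ 2 / (12 + b ^ 3) := by
    unfold barrier; field_simp; ring
  rw [ra] at Ea
  rw [rb] at Eb
  have hle : k * (216 + 6 * ε) * a ^ 2 / (12 + a ^ 3) ≤ l * 216 * b ^ 2 / (12 + b ^ 3) := by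
    linarith
  have hsq : b ^ 2 ≤ a ^ 2 := by nlinarith
  have hcube : a ^ 3 ≤ b ^ 3 := Odd.strictMono_pow (by decide) |>.monotone hab
  have hb2 : 0 < b ^ 2 := sq_pos_of_neg hb
  have h1 : l * 216 * b ^ 2 / (12 + b ^ 3) ≤ l * 216 * b ^ 2 / (12 + a ^ 3) := by
    gcongr
  have h2 : l * 216 * b ^ 2 / (12 + a ^ 3) < k * (216 + 6 * ε) * a ^ 2 / (12 + a ^ 3) := by
    gcongr ?_ / _
    have : l * 216 * b ^ 2 < k * 216 * b ^ 2 := by gcongr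
    have : k * 216 * b ^ 2 ≤ k * (216 + 6 * ε) * a ^ 2 := by
      have : 0 < k := hl.trans hlk
      gcongr
      linarith
    linarith
  linarith

/-- The growth condition bounds `u(a)/u(b)` by a multiple of `((a − ξ*)/(b − ξ*))³`. -/
theorem exp_mul_cube_le {M a b x y : ℝ}
    (hM : ∀ ξ : ℝ, xiStar < ξ → ξ < 0 → ∀ x y : ℝ,
      |v ξ x y - 3 * Real.log (ξ - xiStar)| ≤ M)
    (ha : xiStar < a) (ha0 : a < 0) (hb : xiStar < b) (hb0 : b < 0) :
    Real.exp (v a x y) * (b - xiStar) ^ 3 ≤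
      Real.exp (2 * M) * Real.exp (v b x y) * (a - xiStar) ^ 3 := by
  have h1 := abs_le.1 (hM a ha ha0 x y)
  have h2 := abs_le.1 (hM b hb hb0 x y)
  have e : ∀ c, xiStar < c → (c - xiStar) ^ 3 = Real.exp (3 * Real.log (c - xiStar)) := by
    intro c hc
    rw [mul_comm, Real.exp_mul, Real.exp_log (by linarith)]
    norm_cast
  rw [e a ha, e b hb, ← Real.exp_add, ← Real.exp_add, ← Real.exp_add]
  exact Real.exp_le_exp.2 (by linarith [h1.2, h2.1])

/-- Violations of the penalized inequality stay away from the ends `ξ*` and `0`. -/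
theorem violation_bounds {K : Set (ℝ × ℝ)} (hK : IsCompact K)
    (hC : ContDiffOn ℝ 2 (fun p : ℝ × ℝ × ℝ => v p.1 p.2.1 p.2.2)
      {p : ℝ × ℝ × ℝ | xiStar < p.1 ∧ p.1 ≤ 0})
    {M : ℝ} (hM : ∀ ξ : ℝ, xiStar < ξ → ξ < 0 → ∀ x y : ℝ,
      |v ξ x y - 3 * Real.log (ξ - xiStar)| ≤ M) {ε : ℝ} (hε : 0 < ε) :
    ∃ α β : ℝ, xiStar < α ∧ β < 0 ∧ ∀ a b x y : ℝ, xiStar < a → a ≤ b → b < 0 → (x, y) ∈ K →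
      Real.exp (v b x y) * barrier ε a < Real.exp (v a x y) * barrier 0 b → α ≤ a ∧ b ≤ β := by
  have hz := xiStar_neg
  set E := Real.exp (2 * M) with hE
  have hE0 : 0 < E := Real.exp_pos _
  have hcompact : IsCompact (Set.Icc (xiStar / 2) 0 ×ˢ K) := isCompact_Icc.prod hK
  have hcont : ContinuousOn (fun p : ℝ × ℝ × ℝ => v p.1 p.2.1 p.2.2)
      (Set.Icc (xiStar / 2) 0 ×ˢ K) :=
    hC.continuousOn.mono fun p hp => ⟨by linarith [hp.1.1], hp.1.2⟩
  have hη : 0 < Real.log ((12 + ε / 2) / 12) := Real.log_pos (by rw [lt_div_iff₀] <;> linarith)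
  obtain ⟨δ, hδ, hunif⟩ := Metric.uniformContinuousOn_iff.1
    (hcompact.uniformContinuousOn_of_continuous hcont) _ hη
  set μ := min (min δ (-xiStar / 2)) (min 1 (ε / 2)) with hμ
  have hμ0 : 0 < μ := lt_min (lt_min hδ (by linarith)) (lt_min one_pos (by linarith))
  have hμδ : μ ≤ δ := (min_le_left _ _).trans (min_le_left _ _)
  have hμz : μ ≤ -xiStar / 2 := (min_le_left _ _).trans (min_le_right _ _)
  have hμ1 : μ ≤ 1 := (min_le_right _ _).trans (min_le_left _ _)
  have hμε : μ ≤ ε / 2 := (min_le_right _ _).trans (min_le_right _ _)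
  have hz2 : 0 < xiStar ^ 2 := sq_pos_of_neg hz
  refine ⟨xiStar + ε / (3 * xiStar ^ 2 * E), -(μ * ε / (12 * E)), ?_, ?_, ?_⟩
  · have : 0 < ε / (3 * xiStar ^ 2 * E) := by positivity
    linarith
  · have : 0 < μ * ε / (12 * E) := by positivity
    linarith
  intro a b x y ha hab hb hxy hviol
  have hbz := ha.trans_le hab
  have ha0 := hab.trans_lt hb
  have hua := Real.exp_pos (v a x y)
  have hub := Real.exp_pos (v b x y)
  have hgrow := exp_mul_cube_le (x := x) (y := y) hM ha ha0 hbz hb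
  have Da := twelve_add_cube_pos ha
  have Db := twelve_add_cube_pos hbz
  have Db12 : 12 + b ^ 3 ≤ 12 := by
    have : b ^ 3 < 0 := Odd.pow_neg (by decide) hb
    linarith
  have ra : 0 < a - xiStar := by linarith
  have rb : 0 < b - xiStar := by linarith
  have rab : a - xiStar ≤ b - xiStar := by linarith
  unfold barrier at hviol
  set ua := Real.exp (v a x y)
  set ub := Real.exp (v b x y)
  constructor
  · have h1 : -a * (ub * ε) < -a * (ua * (3 * xiStar ^ 2 * (b - xiStar))) := by
      calc -a * (ub * ε) ≤ ub * (-a * (12 + a ^ 3 + ε)) := by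
            have : 0 ≤ -a * ub * (12 + a ^ 3) := by
              have : 0 < -a := by linarith
              positivity
            linarith
        _ < ua * (-b * (12 + b ^ 3 + 0)) := hviol
        _ ≤ ua * (-a * (3 * xiStar ^ 2 * (b - xiStar))) := by
            have := twelve_add_cube_le hbz hb
            have : 0 < -a := by linarith
            rw [add_zero]
            gcongr
        _ = _ := by ring
    have h2 := lt_of_mul_lt_mul_left h1 (by linarith : 0 ≤ -a)
    have h3 : ub * (b - xiStar) ^ 2 * ε < ub * (b - xiStar) ^ 2 *
        (3 * xiStar ^ 2 * E * (a - xiStar)) := by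
      calc ub * (b - xiStar) ^ 2 * ε = (b - xiStar) ^ 2 * (ub * ε) := by ring
        _ < (b - xiStar) ^ 2 * (ua * (3 * xiStar ^ 2 * (b - xiStar))) := by gcongr
        _ = 3 * xiStar ^ 2 * (ua * (b - xiStar) ^ 3) := by ring
        _ ≤ 3 * xiStar ^ 2 * (E * ub * (a - xiStar) ^ 3) := by gcongr
        _ = 3 * xiStar ^ 2 * (E * ub * ((a - xiStar) ^ 2 * (a - xiStar))) := by ring
        _ ≤ 3 * xiStar ^ 2 * (E * ub * ((b - xiStar) ^ 2 * (a - xiStar))) := by gcongr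
        _ = _ := by ring
    have h4 := lt_of_mul_lt_mul_left h3 (by positivity)
    have : ε / (3 * xiStar ^ 2 * E) < a - xiStar := by
      rw [div_lt_iff₀ (by positivity)]; linarith
    linarith
  · have hμa : μ ≤ -a := by
      by_contra! hlt
      have hd := hunif (a, x, y) ⟨⟨by simp only; linarith, ha0.le⟩, hxy⟩
        (b, x, y) ⟨⟨by simp only; linarith, hb.le⟩, hxy⟩ (by
          rw [Prod.dist_eq, dist_self, max_eq_left dist_nonneg, Real.dist_eq, abs_lt]
          constructor <;> simp only <;> linarith)
      rw [Real.dist_eq, abs_lt] at hd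
      have h1 : ua ≤ ub * ((12 + ε / 2) / 12) := by
        rw [← Real.exp_log (show (0:ℝ) < (12 + ε / 2) / 12 by positivity), ← Real.exp_add]
        exact Real.exp_le_exp.2 (by linarith [hd.2])
      have hcube : -(ε / 2) ≤ a ^ 3 := by
        have : (-a) ^ 3 ≤ (-a) := by
          apply pow_le_of_le_one <;> linarith
        have e : (-a) ^ 3 = -a ^ 3 := by ring
        linarith
      have h2 : ua * (-b * (12 + b ^ 3 + 0)) ≤ ub * (-a * (12 + a ^ 3 + ε)) := by
        calc ua * (-b * (12 + b ^ 3 + 0)) ≤ (ub * ((12 + ε / 2) / 12)) * (-a * 12) := by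
              have : 0 < -b := by linarith
              have : 0 < -a := by linarith
              rw [add_zero]
              gcongr
          _ = ub * (-a * (12 + ε / 2)) := by ring
          _ ≤ ub * (-a * (12 + a ^ 3 + ε)) := by
              have : 0 < -a := by linarith
              gcongr ub * (-a * ?_)
              linarith
      linarith
    have hE' : ua ≤ E * ub := by
      have h3 : ua * (b - xiStar) ^ 3 ≤ E * ub * (b - xiStar) ^ 3 := by
        refine hgrow.trans ?_
        gcongr
      exact le_of_mul_le_mul_right h3 (by positivity)
    have h1 : ub * (μ * ε) < ub * (12 * E * -b) := by
      calc ub * (μ * ε) ≤ ub * (-a * (12 + a ^ 3 + ε)) := by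
            gcongr
            · linarith
            · linarith
        _ < ua * (-b * (12 + b ^ 3 + 0)) := hviol
        _ ≤ E * ub * (-b * 12) := by
            have : 0 < -b := by linarith
            rw [add_zero]
            gcongr
        _ = _ := by ring
    have h2 := lt_of_mul_lt_mul_left h1 hub.le
    have : μ * ε / (12 * E) < -b := by
      rw [div_lt_iff₀ (by positivity)]; linarith
    linarith

/-- Two-point maximum principle for the penalized quotient. -/
theorem exp_mul_barrier_le {v1 v2 : ℝ × ℝ} (hdet : |v1.1 * v2.2 - v1.2 * v2.1| = 1)
    {φ : ℝ → ℝ → ℝ} (hv : IsSolBVP3 v1 v2 φ v) {ε : ℝ} (hε : 0 < ε) {a b : ℝ} (x y : ℝ)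
    (ha : xiStar < a) (hab : a ≤ b) (hb : b < 0) :
    Real.exp (v a x y) * barrier 0 b ≤ Real.exp (v b x y) * barrier ε a := by
  obtain ⟨hC, hper, -, ⟨M, hM⟩, hT⟩ := hv
  by_contra! hviol
  set K := fundamentalCell v1 v2
  have hK : IsCompact K := isCompact_fundamentalCell v1 v2
  obtain ⟨α, β, hα, hβ, hout⟩ := violation_bounds hK hC hM hε
  set T : Set (ℝ × ℝ × ℝ × ℝ) := (Set.Icc α β ×ˢ (Set.Icc α β ×ˢ K)) ∩ {p | p.1 ≤ p.2.1}
  set F : ℝ × ℝ × ℝ × ℝ → ℝ := fun p =>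
    Real.exp (v p.1 p.2.2.1 p.2.2.2) * barrier 0 p.2.1 /
      (Real.exp (v p.2.1 p.2.2.1 p.2.2.2) * barrier ε p.1) with hF
  have hTc : IsCompact T := (isCompact_Icc.prod (isCompact_Icc.prod hK)).inter_right
    (isClosed_le (by fun_prop) (by fun_prop))
  have hFc : ContinuousOn F T := by
    have c1 : ContinuousOn (fun p : ℝ × ℝ × ℝ × ℝ => v p.1 p.2.2.1 p.2.2.2) T :=
      hC.continuousOn.comp (f := fun p : ℝ × ℝ × ℝ × ℝ => (p.1, p.2.2.1, p.2.2.2))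
        (by fun_prop) fun p hp => ⟨hα.trans_le hp.1.1.1, hp.1.1.2.trans hβ.le⟩
    have c2 : ContinuousOn (fun p : ℝ × ℝ × ℝ × ℝ => v p.2.1 p.2.2.1 p.2.2.2) T :=
      hC.continuousOn.comp (f := fun p : ℝ × ℝ × ℝ × ℝ => (p.2.1, p.2.2.1, p.2.2.2))
        (by fun_prop) fun p hp => ⟨hα.trans_le hp.1.2.1.1, hp.1.2.1.2.trans hβ.le⟩
    have b1 : Continuous fun p : ℝ × ℝ × ℝ × ℝ => barrier 0 p.2.1 :=
      (contDiff_barrier 0).continuous.comp (by fun_prop)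
    have b2 : Continuous fun p : ℝ × ℝ × ℝ × ℝ => barrier ε p.1 :=
      (contDiff_barrier ε).continuous.comp (by fun_prop)
    refine (c1.rexp.mul b1.continuousOn).div (c2.rexp.mul b2.continuousOn) fun p hp => ?_
    exact (mul_pos (Real.exp_pos _) (barrier_pos hε.le (hα.trans_le hp.1.1.1)
      (hp.1.1.2.trans_lt hβ))).ne'
  have hpos : ∀ c d x y : ℝ, xiStar < c → c < 0 → 0 < Real.exp (v d x y) * barrier ε c :=
    fun c d x y h h0 => mul_pos (Real.exp_pos _) (barrier_pos hε.le h h0)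
  have hcell : ∀ c d x y : ℝ, xiStar < c → c ≤ d → d < 0 → 1 < F (c, d, x, y) →
      ∃ q ∈ T, F (c, d, x, y) = F q := by
    intro c d x y hc hcd hd h1
    obtain ⟨q, hq, hqf⟩ := exists_mem_fundamentalCell hdet x y
    have e : F (c, d, x, y) = F (c, d, q.1, q.2) := by
      simp only [hF]
      rw [hqf _ (hper c hc (hcd.trans hd.le)), hqf _ (hper d (hc.trans_le hcd) hd.le)]
    refine ⟨(c, d, q), ?_, e⟩
    rw [e] at h1
    simp only [hF] at h1
    rw [one_lt_div (hpos c d _ _ hc (hcd.trans_lt hd))] at h1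
    obtain ⟨h2, h3⟩ := hout c d q.1 q.2 hc hcd hd hq h1
    exact ⟨⟨⟨h2, hcd.trans h3⟩, ⟨h2.trans hcd, h3⟩, hq⟩, hcd⟩
  have h1 : 1 < F (a, b, x, y) := by
    simp only [hF]
    rwa [one_lt_div (hpos a b _ _ ha (hab.trans_lt hb))]
  obtain ⟨q, hqT, hq⟩ := hcell a b x y ha hab hb h1
  obtain ⟨⟨a', b', x', y'⟩, hmT, hmax⟩ := hTc.exists_isMaxOn ⟨q, hqT⟩ hFc
  set κ := F (a', b', x', y') with hκ
  have hκ1 : 1 < κ := h1.trans_le (hq.le.trans (hmax hqT))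
  have hglob : ∀ c d x y : ℝ, xiStar < c → c ≤ d → d < 0 →
      Real.exp (v c x y) * barrier 0 d ≤ κ * (Real.exp (v d x y) * barrier ε c) := by
    intro c d x y hc hcd hd
    rw [← div_le_iff₀ (hpos c d x y hc (hcd.trans_lt hd))]
    rcases lt_or_ge 1 (F (c, d, x, y)) with h | h
    · obtain ⟨q, hqT, hq⟩ := hcell c d x y hc hcd hd h
      exact hq.le.trans (hmax hqT)
    · exact h.trans hκ1.le
  have ha' : xiStar < a' := hα.trans_le hmT.1.1.1
  have hb' : b' < 0 := hmT.1.2.1.2.trans_lt hβ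
  have hab' : a' ≤ b' := hmT.2
  have ha0' : a' < 0 := hab'.trans_lt hb'
  have hbz' := ha'.trans_le hab'
  have hκeq : Real.exp (v a' x' y') * barrier 0 b' =
      κ * (Real.exp (v b' x' y') * barrier ε a') :=
    (div_eq_iff (hpos a' b' x' y' ha' ha0').ne').1 rfl
  have hQ := barrier_pos hε.le ha' ha0'
  have hP := barrier_pos le_rfl hbz' hb'
  have hlt : a' < b' := by
    refine lt_of_le_of_ne hab' fun h => ?_
    rw [← h] at hκeq
    have hP' := barrier_pos le_rfl ha' ha0'
    have hPQ : barrier 0 a' < barrier ε a' := by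
      unfold barrier
      nlinarith
    have h3 := mul_lt_mul_of_pos_left hPQ (Real.exp_pos (v a' x' y'))
    have h4 := hpos a' a' x' y' ha' ha0'
    nlinarith
  set l := Real.exp (v b' x' y') / barrier 0 b' with hl
  have hl0 : 0 < l := by positivity
  have hlb : Real.exp (v b' x' y') = l * barrier 0 b' := by rw [hl]; field_simp
  have hka : Real.exp (v a' x' y') = κ * l * barrier ε a' := by
    rw [hl]; field_simp; linarith
  refine no_interior_touching hC hT hε.le hl0 (by nlinarith : l < κ * l) ha' hab' hb' hka hlb
    ?_ ?_ ?_ ?_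
  · filter_upwards [Ioo_mem_nhds ha' hlt] with s hs
    rw [hka, sub_self]
    have := hglob s b' x' y' hs.1 hs.2.le hb'
    rw [hlb] at this
    have : Real.exp (v s x' y') * barrier 0 b' ≤ κ * l * barrier ε s * barrier 0 b' := by
      linarith
    linarith [le_of_mul_le_mul_right this hP]
  · filter_upwards [Ioo_mem_nhds hlt hb'] with s hs
    rw [hlb, sub_self]
    have := hglob a' s x' y' ha' hs.1.le hs.2
    rw [hka] at this
    have : l * barrier 0 s * (κ * barrier ε a') ≤ Real.exp (v s x' y') * (κ * barrier ε a') := by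
      linarith
    linarith [le_of_mul_le_mul_right this (by positivity)]
  all_goals
    refine .of_forall fun s => ?_
    simp only
  · have := hglob a' b' s y' ha' hab' hb'
    have h2 : Real.exp (v a' s y') * Real.exp (v b' x' y') ≤
        Real.exp (v b' s y') * Real.exp (v a' x' y') := by
      rw [hlb, hka]
      linarith [mul_le_mul_of_nonneg_left this hl0.le]
    rw [← Real.exp_add, ← Real.exp_add, Real.exp_le_exp] at h2
    linarith
  · have := hglob a' b' x' s ha' hab' hb'
    have h2 : Real.exp (v a' x' s) * Real.exp (v b' x' y') ≤
        Real.exp (v b' x' s) * Real.exp (v a' x' y') := by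
      rw [hlb, hka]
      linarith [mul_le_mul_of_nonneg_left this hl0.le]
    rw [← Real.exp_add, ← Real.exp_add, Real.exp_le_exp] at h2
    linarith

/-- `e^v / (−ξ(12 + ξ³))` is nondecreasing in `ξ`. -/
theorem monotoneOn_exp_div_barrier {v1 v2 : ℝ × ℝ} (hdet : |v1.1 * v2.2 - v1.2 * v2.1| = 1)
    {φ : ℝ → ℝ → ℝ} (hv : IsSolBVP3 v1 v2 φ v) (x y : ℝ) :
    MonotoneOn (fun s => Real.exp (v s x y) / barrier 0 s) (Set.Ioo xiStar 0) := by
  intro a ha b hb hab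
  simp only
  rw [div_le_div_iff₀ (barrier_pos le_rfl ha.1 ha.2) (barrier_pos le_rfl hb.1 hb.2)]
  refine le_of_forall_pos_le_add fun η hη => ?_
  have hc : 0 < Real.exp (v b x y) * -a := mul_pos (Real.exp_pos _) (by linarith [ha.2])
  have := exp_mul_barrier_le hdet hv (div_pos hη hc) x y ha.1 hab hb.2
  refine this.trans_eq ?_
  have ha0 : a ≠ 0 := ha.2.ne
  unfold barrier
  field_simp
  ring

end Slices

/-- Positivity of `W = (12 − 6ξv_ξ)/(12 + ξ³)` for solutions of BVP3. -/
theorem stmt12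
    (v1 v2 : ℝ × ℝ) (hdet : |v1.1 * v2.2 - v1.2 * v2.1| = 1)
    (φ : ℝ → ℝ → ℝ)
    (hφreg : ContDiff ℝ (⊤ : ℕ∞) (fun p : ℝ × ℝ => φ p.1 p.2))
    (hφper : LatticePeriodic v1 v2 φ)
    (v : ℝ → ℝ → ℝ → ℝ) (hv : IsSolBVP3 v1 v2 φ v) :
    ∀ ξ : ℝ, xiStar < ξ → ξ ≤ 0 → ∀ x y : ℝ,
      0 < (12 - 6 * ξ * deriv (fun s => v s x y) ξ) / (12 + ξ ^ 3) := by
  intro ξ hξ hξ0 x y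
  have D := twelve_add_cube_pos hξ
  refine div_pos ?_ D
  rcases hξ0.eq_or_lt with rfl | hneg
  · norm_num
  have hd := (contDiffAt_slice_fst
    (contDiffAt_of_contDiffOn hv.1 hξ hneg x y)).differentiableAt (by simp) |>.hasDerivAt
  set p := deriv (fun s => v s x y) ξ
  have hP := barrier_pos le_rfl hξ hneg
  have hbar : HasDerivAt (barrier 0) (-(12 + 4 * ξ ^ 3 + 0)) ξ := by
    have := ((contDiff_barrier 0).differentiable (by simp) ξ).hasDerivAt
    rwa [deriv_barrier] at this
  have hq := hd.exp.div hbar hP.ne'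
  have hnonneg := (monotoneOn_exp_div_barrier hdet hv x y).derivWithin_nonneg (x := ξ)
  rw [derivWithin_of_isOpen isOpen_Ioo ⟨hξ, hneg⟩] at hnonneg
  have h1 := hnonneg.trans_eq hq.deriv
  rw [le_div_iff₀ (by positivity), zero_mul] at h1
  have h2 : 0 ≤ Real.exp (v ξ x y) * (p * barrier 0 ξ + (12 + 4 * ξ ^ 3)) := by linarith
  have h3 := nonneg_of_mul_nonneg_right h2 (Real.exp_pos _)
  have hcube : ξ ^ 3 < 0 := Odd.pow_neg (by decide) hneg
  unfold barrier at h3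
  have h4 : 0 < (2 - ξ * p) * (12 + ξ ^ 3) := by linarith
  linarith [pos_of_mul_pos_left h4 D.le]
end
end
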